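/- arXiv:1504.00148 — 6 statements merged into one kernel-verified Lean document; each statement's English description precedes it below -/
import Mathlib

section
/- Let p ≥ 3 be a prime and 2p+1 ≤ r with r ≡ a mod (p−1), 1 ≤ a ≤ p−1. Then there is a short exact sequence of Γ-equivariant F_p-linear maps: 0 → V_{p−2} ⊗ D → V_r^*/V_r^{**} → V_1 → 0 if a = 1; 0 → V_{p−1} ⊗ D → V_r^*/V_r^{**} → V_0 ⊗ D → 0 if a = 2; and 0 → V_{a−2} ⊗ D → V_r^*/V_r^{**} → V_{p−a+1} ⊗ D^{a−1} → 0 if 3 ≤ a ≤ p−1. These sequences split as sequences of Γ-modules if and only if a = 2. -/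
open MvPolynomial

/-- The action of a 2×2 matrix `g` over `F_p` on polynomials in two variables:
`((a b; c d) · F)(X, Y) = F (aX + cY, bX + dY)`. -/
noncomputable def matAct (p : ℕ) (g : Matrix (Fin 2) (Fin 2) (ZMod p)) :
    MvPolynomial (Fin 2) (ZMod p) →ₐ[ZMod p] MvPolynomial (Fin 2) (ZMod p) :=
  aeval fun i => ∑ j, C (g j i) * X j

/-- The action of `g` twisted by the `n`-th power of the determinant character `D`. -/
noncomputable def twAct (p n : ℕ) (g : Matrix (Fin 2) (Fin 2) (ZMod p))
    (F : MvPolynomial (Fin 2) (ZMod p)) : MvPolynomial (Fin 2) (ZMod p) :=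
  g.det ^ n • matAct p g F

/-- `V_m`: homogeneous polynomials of degree `m` in two variables over `F_p`. -/
noncomputable def Vh (p m : ℕ) : Submodule (ZMod p) (MvPolynomial (Fin 2) (ZMod p)) :=
  homogeneousSubmodule (Fin 2) (ZMod p) m

/-- `X_r`: the `M`-submodule of `V_r` generated by `X^r`, realized as the span of the
orbit of `X^r` under the monoid `M = M_2(F_p)`. -/
noncomputable def XrSub (p r : ℕ) : Submodule (ZMod p) (MvPolynomial (Fin 2) (ZMod p)) :=
  Submodule.span (ZMod p)
    (Set.range fun g : Matrix (Fin 2) (Fin 2) (ZMod p) => matAct p g (X 0 ^ r))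

/-- `X_{r-1}`: the `M`-submodule of `V_r` generated by `X^{r-1} Y`. -/
noncomputable def Xr1Sub (p r : ℕ) : Submodule (ZMod p) (MvPolynomial (Fin 2) (ZMod p)) :=
  Submodule.span (ZMod p)
    (Set.range fun g : Matrix (Fin 2) (Fin 2) (ZMod p) => matAct p g (X 0 ^ (r - 1) * X 1))

/-- The special polynomial `θ = X^p Y − X Y^p`. -/
noncomputable def theta (p : ℕ) : MvPolynomial (Fin 2) (ZMod p) :=
  X 0 ^ p * X 1 - X 0 * X 1 ^ p

/-- `V_r^* = {F ∈ V_r : θ ∣ F}`. -/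
noncomputable def Vstar (p r : ℕ) : Submodule (ZMod p) (MvPolynomial (Fin 2) (ZMod p)) :=
  Vh p r ⊓ (Ideal.span {theta p}).restrictScalars (ZMod p)

/-- `V_r^{**} = {F ∈ V_r : θ² ∣ F}`. -/
noncomputable def Vdstar (p r : ℕ) : Submodule (ZMod p) (MvPolynomial (Fin 2) (ZMod p)) :=
  Vh p r ⊓ (Ideal.span {theta p ^ 2}).restrictScalars (ZMod p)

/-- `M`-equivariance of a linear map between two submodules of the polynomial ring,
where the source carries the action twisted by `D^{nA}` and the target by `D^{nB}`. -/
def EquivMap (p nA nB : ℕ)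
    {A B : Submodule (ZMod p) (MvPolynomial (Fin 2) (ZMod p))}
    (φ : A →ₗ[ZMod p] B) : Prop :=
  ∀ (g : Matrix (Fin 2) (Fin 2) (ZMod p)) (x y : A),
    (y : MvPolynomial (Fin 2) (ZMod p)) = twAct p nA g (x : MvPolynomial (Fin 2) (ZMod p)) →
    (φ y : MvPolynomial (Fin 2) (ZMod p)) = twAct p nB g (φ x : MvPolynomial (Fin 2) (ZMod p))


/-- The quotient `V_r^*/V_r^{**}`. -/
abbrev starQuot (p r : ℕ) :=
  ↥(Vstar p r) ⧸ (Vdstar p r).comap (Vstar p r).subtype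

/-- A short exact sequence of `Γ = GL_2(F_p)`-equivariant maps
`0 → V_{m₁} ⊗ D^{n₁} → V_r^*/V_r^{**} → V_{m₂} ⊗ D^{n₂} → 0`, which splits
(`Γ`-equivariantly) if and only if `splitCond` holds. -/
def StarSES (p r m₁ n₁ m₂ n₂ : ℕ) (splitCond : Prop) : Prop :=
  ∃ (ι : ↥(Vh p m₁) →ₗ[ZMod p] starQuot p r)
    (π : starQuot p r →ₗ[ZMod p] ↥(Vh p m₂)),
    Function.Injective ι ∧ Function.Surjective π ∧
    LinearMap.ker π = LinearMap.range ι ∧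
    -- `Γ`-equivariance of `ι`
    (∀ g : Matrix (Fin 2) (Fin 2) (ZMod p), IsUnit g →
      ∀ (x y : ↥(Vh p m₁)) (F F' : ↥(Vstar p r)),
        (y : MvPolynomial (Fin 2) (ZMod p)) = twAct p n₁ g (x : MvPolynomial (Fin 2) (ZMod p)) →
        ι x = Submodule.Quotient.mk F →
        (F' : MvPolynomial (Fin 2) (ZMod p)) = matAct p g (F : MvPolynomial (Fin 2) (ZMod p)) →
        ι y = Submodule.Quotient.mk F') ∧
    -- `Γ`-equivariance of `π`
    (∀ g : Matrix (Fin 2) (Fin 2) (ZMod p), IsUnit g →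
      ∀ (F F' : ↥(Vstar p r)),
        (F' : MvPolynomial (Fin 2) (ZMod p)) = matAct p g (F : MvPolynomial (Fin 2) (ZMod p)) →
        (π (Submodule.Quotient.mk F') : MvPolynomial (Fin 2) (ZMod p)) =
          twAct p n₂ g (π (Submodule.Quotient.mk F) : MvPolynomial (Fin 2) (ZMod p))) ∧
    -- splitting criterion
    ((∃ s : ↥(Vh p m₂) →ₗ[ZMod p] starQuot p r,
        π.comp s = LinearMap.id ∧
        ∀ g : Matrix (Fin 2) (Fin 2) (ZMod p), IsUnit g →
          ∀ (x y : ↥(Vh p m₂)) (F F' : ↥(Vstar p r)),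
            (y : MvPolynomial (Fin 2) (ZMod p)) =
              twAct p n₂ g (x : MvPolynomial (Fin 2) (ZMod p)) →
            s x = Submodule.Quotient.mk F →
            (F' : MvPolynomial (Fin 2) (ZMod p)) =
              matAct p g (F : MvPolynomial (Fin 2) (ZMod p)) →
            s y = Submodule.Quotient.mk F') ↔ splitCond)


section Helpers

variable {p : ℕ}

theorem eval_matAct (g : Matrix (Fin 2) (Fin 2) (ZMod p)) (F : MvPolynomial (Fin 2) (ZMod p))
    (w : Fin 2 → ZMod p) : eval w (matAct p g F) = eval (Matrix.vecMul w g) F := by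
  have h : (aeval w : _ →ₐ[ZMod p] ZMod p).comp (matAct p g) = aeval (Matrix.vecMul w g) := by
    ext i
    simp [matAct, Matrix.vecMul, dotProduct, mul_comm]
  simpa [coe_aeval_eq_eval] using DFunLike.congr_fun h F

theorem matAct_mem_Vh (g : Matrix (Fin 2) (Fin 2) (ZMod p)) {m : ℕ}
    {F : MvPolynomial (Fin 2) (ZMod p)} (hF : F ∈ Vh p m) : matAct p g F ∈ Vh p m := by
  have h := IsHomogeneous.aeval (S := ZMod p) (show F.IsHomogeneous m from hF)
    (fun i => ∑ j, C (g j i) * X j)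
    (n := 1) (fun i => IsHomogeneous.sum _ _ _ fun j _ => isHomogeneous_C_mul_X _ _)
  rw [one_mul] at h
  exact h

theorem X_pow_mul_X_pow_mem_Vh (i j : ℕ) :
    (X 0 ^ i * X 1 ^ j : MvPolynomial (Fin 2) (ZMod p)) ∈ Vh p (i + j) :=
  (isHomogeneous_X_pow 0 i).mul (isHomogeneous_X_pow 1 j)

theorem X_pow_mul_X_pow_eq_monomial (i j : ℕ) :
    (X 0 ^ i * X 1 ^ j : MvPolynomial (Fin 2) (ZMod p)) =
      monomial (Finsupp.single 0 i + Finsupp.single 1 j) 1 := by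
  rw [X_pow_eq_monomial, X_pow_eq_monomial, monomial_mul, one_mul]

/-- The homogeneous polynomials of degree `m` are spanned by the monomials of degree `m`. -/
theorem Vh_le_span (m : ℕ) :
    Vh p m ≤ Submodule.span (ZMod p)
      {F | ∃ i j, i + j = m ∧ F = (X 0 ^ i * X 1 ^ j : MvPolynomial (Fin 2) (ZMod p))} := by
  intro F hF
  rw [F.as_sum]
  refine Submodule.sum_mem _ fun d hd => ?_
  have hd' := IsHomogeneous.degree_eq_sum_deg_support (show F.IsHomogeneous m from hF) hd
  have : monomial d (coeff d F) = coeff d F • (X 0 ^ d 0 * X 1 ^ d 1) := by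
    rw [monomial_eq, smul_eq_C_mul, Finsupp.prod_fintype _ _ (by simp)]
    simp
  rw [this]
  refine Submodule.smul_mem _ _ (Submodule.subset_span ⟨_, _, ?_, rfl⟩)
  rw [hd']
  simpa using (Finset.sum_subset (Finset.subset_univ d.support) (f := d) (by simp)).symm

theorem theta_mem_Vh : theta p ∈ Vh p (p + 1) :=
  ((isHomogeneous_X_pow 0 p).mul (isHomogeneous_X _ 1)).sub
    (by simpa [add_comm] using (isHomogeneous_X (ZMod p) (0 : Fin 2)).mul (isHomogeneous_X_pow 1 p))

/-- Multiplication by `θ`, from `V_m` onto `V_{m+p+1}^*`. -/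
noncomputable def mulTheta (p m : ℕ) : ↥(Vh p m) →ₗ[ZMod p] ↥(Vstar p (m + p + 1)) :=
  ((LinearMap.mulLeft (ZMod p) (theta p)).comp (Vh p m).subtype).codRestrict _ fun G => by
    refine ⟨?_, Ideal.mul_mem_right _ _ (Ideal.mem_span_singleton_self _)⟩
    have := IsHomogeneous.mul (theta_mem_Vh (p := p)) (mem_homogeneousSubmodule m _ |>.1 G.2)
    rw [show m + p + 1 = p + 1 + m by ring]
    exact this

theorem coe_mulTheta {m : ℕ} (G : ↥(Vh p m)) :
    (mulTheta p m G : MvPolynomial (Fin 2) (ZMod p)) = theta p * G := rfl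

variable [Fact p.Prime]

theorem matAct_theta (g : Matrix (Fin 2) (Fin 2) (ZMod p)) :
    matAct p g (theta p) = g.det • theta p := by
  have h : ∀ a : ZMod p, (C a : MvPolynomial (Fin 2) (ZMod p)) ^ p = C a := fun a => by
    rw [← C_pow, ZMod.pow_card]
  simp only [matAct, theta, map_sub, map_mul, map_pow, aeval_X, Fin.sum_univ_two, add_pow_char,
    mul_pow, h, Matrix.det_fin_two, smul_eq_C_mul]
  ring

theorem theta_ne_zero : theta p ≠ 0 := by
  intro h
  have hp := (Fact.out : p.Prime).two_le
  have h1 := X_pow_mul_X_pow_eq_monomial (p := p) p 1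
  have h2 := X_pow_mul_X_pow_eq_monomial (p := p) 1 p
  rw [pow_one] at h1 h2
  have := congrArg (coeff (Finsupp.single 0 p + Finsupp.single 1 1)) h
  rw [theta, h1, h2, coeff_sub, coeff_monomial, coeff_monomial, if_pos rfl, if_neg] at this
  · simp at this
  · intro h3
    have := DFunLike.congr_fun h3 0
    simp at this
    omega

theorem eval_theta (w : Fin 2 → ZMod p) : eval w (theta p) = 0 := by
  simp [theta, ZMod.pow_card]

theorem sum_zmod_pow {N : ℕ} (hN : 0 < N) :
    ∑ x : ZMod p, x ^ N = if p - 1 ∣ N then -1 else 0 := by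
  have h := FiniteField.sum_pow_units (ZMod p) N
  rw [ZMod.card] at h
  rw [← h, Fintype.sum_eq_add_sum_compl 0, zero_pow hN.ne', zero_add]
  symm
  refine Finset.sum_bij (fun u _ => (u : ZMod p)) (by simp) (fun _ _ _ _ h => Units.ext h) ?_
    (fun _ _ => rfl)
  intro b hb
  exact ⟨Units.mk0 b (by simpa using hb), Finset.mem_univ _, rfl⟩

theorem theta_dvd_reduce (i t s : ℕ) (hi : 1 ≤ i) (hs : 1 ≤ s) :
    theta p ∣ X 0 ^ (i + t * (p - 1)) * X 1 ^ s - X 0 ^ i * X 1 ^ (s + t * (p - 1)) := by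
  have hp := (Fact.out : p.Prime).one_le
  induction t generalizing s with
  | zero => simp
  | succ t ih =>
    have h := ih (s + (p - 1)) (by omega)
    obtain ⟨i, rfl⟩ := Nat.exists_eq_add_of_le' hi
    obtain ⟨s, rfl⟩ := Nat.exists_eq_add_of_le' hs
    obtain ⟨q, rfl⟩ := Nat.exists_eq_add_of_le' hp
    have e : (X 0 ^ (i + 1 + (t + 1) * (q + 1 - 1)) * X 1 ^ (s + 1) -
        X 0 ^ (i + 1) * X 1 ^ (s + 1 + (t + 1) * (q + 1 - 1)) :
          MvPolynomial (Fin 2) (ZMod (q + 1))) =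
        theta (q + 1) * (X 0 ^ (i + t * q) * X 1 ^ s) +
        (X 0 ^ (i + 1 + t * (q + 1 - 1)) * X 1 ^ (s + 1 + (q + 1 - 1)) - X 0 ^ (i + 1) *
          X 1 ^ (s + 1 + (q + 1 - 1) + t * (q + 1 - 1))) := by
      simp only [theta, Nat.add_sub_cancel]
      ring
    rw [e]
    exact dvd_add (dvd_mul_right _ _) h

/-- Modulo `θ`, every form of degree `m` is a combination of `X^m` and the `X^i Y^(m-i)` with
`i < p`. -/
theorem exists_theta_dvd_sub {m : ℕ} {H : MvPolynomial (Fin 2) (ZMod p)} (hH : H ∈ Vh p m) :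
    ∃ (c : ZMod p) (d : Fin p → ZMod p),
      theta p ∣ H - (c • X 0 ^ m + ∑ i : Fin p, d i • (X 0 ^ (i : ℕ) * X 1 ^ (m - i))) := by
  have hp := (Fact.out : p.Prime).two_le
  refine Submodule.span_induction (p := fun H _ => ∃ (c : ZMod p) (d : Fin p → ZMod p),
      theta p ∣ H - (c • X 0 ^ m + ∑ i : Fin p, d i • (X 0 ^ (i : ℕ) * X 1 ^ (m - i))))
    ?_ ⟨0, 0, by simp⟩ ?_ ?_ (Vh_le_span m hH)
  · rintro _ ⟨i, j, rfl, rfl⟩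
    rcases Nat.eq_zero_or_pos j with rfl | hj
    · exact ⟨1, 0, by simp⟩
    rcases Nat.lt_or_ge i p with hi | hi
    · refine ⟨0, Pi.single ⟨i, hi⟩ 1, ?_⟩
      rw [Fintype.sum_eq_single ⟨i, hi⟩ (fun x hx => by simp [hx])]
      simp
    · obtain ⟨e, t, he1, he2, rfl⟩ : ∃ e t, 1 ≤ e ∧ e < p ∧ i = e + t * (p - 1) := by
        refine ⟨(i - 1) % (p - 1) + 1, (i - 1) / (p - 1), by omega, ?_, ?_⟩
        · have := Nat.mod_lt (i - 1) (show p - 1 > 0 by omega)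
          omega
        · have := Nat.mod_add_div (i - 1) (p - 1)
          rw [mul_comm] at this
          omega
      refine ⟨0, Pi.single ⟨e, he2⟩ 1, ?_⟩
      rw [Fintype.sum_eq_single ⟨e, he2⟩ (fun x hx => by simp [hx])]
      have := theta_dvd_reduce (p := p) e t j he1 hj
      rw [show j + t * (p - 1) = e + t * (p - 1) + j - e by omega] at this
      simpa using this
  · rintro x y _ _ ⟨c, d, h⟩ ⟨c', d', h'⟩
    refine ⟨c + c', d + d', ?_⟩
    convert dvd_add h h' using 1
    simp only [Pi.add_apply, add_smul, Finset.sum_add_distrib]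
    ring
  · rintro a x _ ⟨c, d, h⟩
    refine ⟨a * c, a • d, ?_⟩
    convert h.mul_left (C a) using 1
    simp only [Pi.smul_apply, smul_eq_C_mul, smul_eq_mul, C_mul, mul_sub, mul_add,
      Finset.mul_sum, mul_assoc]

theorem theta_dvd_of_eval_eq_zero {m : ℕ} (hm : p ≤ m) {H : MvPolynomial (Fin 2) (ZMod p)}
    (hH : H ∈ Vh p m) (h0 : ∀ w, eval w H = 0) : theta p ∣ H := by
  have hp := (Fact.out : p.Prime).two_le
  obtain ⟨c, d, h⟩ := exists_theta_dvd_sub hH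
  have hev : ∀ w : Fin 2 → ZMod p,
      c * w 0 ^ m + ∑ i : Fin p, d i * (w 0 ^ (i : ℕ) * w 1 ^ (m - i)) = 0 := by
    intro w
    obtain ⟨q, hq⟩ := h
    have := congrArg (eval w) hq
    simpa [eval_theta, h0, smul_eval, ← neg_add_rev, -neg_add_rev] using this
  have hc : c = 0 := by
    have := hev ![1, 0]
    rw [Finset.sum_eq_zero] at this
    · simpa using this
    · intro i _
      have : m - (i : ℕ) ≠ 0 := by omega
      simp [this]
  have hd : ∀ i, d i = 0 := by
    have hq : (∑ i : Fin p, Polynomial.C (d i) * Polynomial.X ^ (i : ℕ) :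
        Polynomial (ZMod p)) = 0 := by
      refine Polynomial.eq_zero_of_natDegree_lt_card_of_eval_eq_zero _
        (f := fun x : ZMod p => x) Function.injective_id (fun x => ?_) ?_
      · have := hev ![x, 1]
        simpa [hc, Polynomial.eval_finsetSum] using this
      · rw [ZMod.card]
        refine lt_of_le_of_lt
          (Polynomial.natDegree_sum_le_of_forall_le (n := p - 1) _ _ ?_) (by omega)
        intro i _
        exact (Polynomial.natDegree_C_mul_X_pow_le _ _).trans (by omega)
    intro i
    have := congrArg (fun q => Polynomial.coeff q i) hq
    simpa [Polynomial.finsetSum_coeff, Polynomial.coeff_C_mul, Polynomial.coeff_X_pow,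
      Fin.val_inj] using this
  simpa [hc, hd] using h

theorem mulTheta_bijective (m : ℕ) : Function.Bijective (mulTheta p m) := by
  constructor
  · intro G G' h
    have := congrArg Subtype.val h
    rw [coe_mulTheta, coe_mulTheta] at this
    exact Subtype.ext (mul_left_cancel₀ theta_ne_zero this)
  · rintro ⟨F, hF, hd⟩
    obtain ⟨q, hq⟩ := Ideal.mem_span_singleton.1 hd
    let _ : GradedRing (homogeneousSubmodule (Fin 2) (ZMod p)) := gradedAlgebra
    have h := DirectSum.coe_decompose_mul_add_of_left_mem (homogeneousSubmodule (Fin 2) (ZMod p))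
      (j := m) (b := q) (theta_mem_Vh (p := p))
    rw [← hq, show p + 1 + m = m + p + 1 by ring,
      DirectSum.decompose_of_mem_same (homogeneousSubmodule (Fin 2) (ZMod p)) hF] at h
    exact ⟨DirectSum.decompose (homogeneousSubmodule (Fin 2) (ZMod p)) q m, Subtype.ext h.symm⟩

/-- The functions on `F_p²`. -/
abbrev PlaneFun (p : ℕ) := (Fin 2 → ZMod p) → ZMod p

/-- `V_r^*/V_r^{**}` is the space of functions on `F_p²` given by forms of degree `r - p - 1`,
through `θ G ↦ G`. -/
theorem exists_starQuot_eval {m : ℕ} (hm : p ≤ m) :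
    ∃ E : starQuot p (m + p + 1) →ₗ[ZMod p] PlaneFun p, Function.Injective E ∧
      (∀ G ∈ Vh p m, ∃ q, E q = fun w => eval w G) ∧
      (∀ q, ∃ G ∈ Vh p m, E q = fun w => eval w G) ∧
      ∀ (g : Matrix (Fin 2) (Fin 2) (ZMod p)) (F F' : ↥(Vstar p (m + p + 1))),
        (F' : MvPolynomial (Fin 2) (ZMod p)) = matAct p g (F : MvPolynomial (Fin 2) (ZMod p)) →
        ∀ w, E (Submodule.Quotient.mk F') w =
          g.det * E (Submodule.Quotient.mk F) (Matrix.vecMul w g) := by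
  let e := LinearEquiv.ofBijective (mulTheta p m) (mulTheta_bijective m)
  let ev : ↥(Vh p m) →ₗ[ZMod p] PlaneFun p := (evalₗ (ZMod p) (Fin 2)).comp (Vh p m).subtype
  let E₀ : ↥(Vstar p (m + p + 1)) →ₗ[ZMod p] PlaneFun p := ev.comp e.symm.toLinearMap
  have hE₀ : ∀ G, E₀ (mulTheta p m G) = fun w => eval w (G : MvPolynomial (Fin 2) (ZMod p)) := by
    intro G
    have : e.symm (mulTheta p m G) = G := e.symm_apply_apply G
    ext w
    simp [E₀, ev, this]
  have hker : LinearMap.ker E₀ =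
      (Vdstar p (m + p + 1)).comap (Vstar p (m + p + 1)).subtype := by
    ext F
    obtain ⟨G, rfl⟩ := (mulTheta_bijective m).2 F
    rw [LinearMap.mem_ker, hE₀, Submodule.mem_comap]
    constructor
    · intro h
      obtain ⟨q, hq⟩ := theta_dvd_of_eval_eq_zero hm G.2 fun w => congrFun h w
      refine ⟨(mulTheta p m G).2.1, Ideal.mem_span_singleton.2 ⟨q, ?_⟩⟩
      rw [Submodule.subtype_apply, coe_mulTheta, hq]
      ring
    · rintro ⟨-, h⟩
      obtain ⟨q, hq⟩ := Ideal.mem_span_singleton.1 h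
      rw [Submodule.subtype_apply, coe_mulTheta, pow_two, mul_assoc] at hq
      rw [mul_left_cancel₀ theta_ne_zero hq]
      ext w
      simp [eval_theta]
  let E : starQuot p (m + p + 1) →ₗ[ZMod p] PlaneFun p := Submodule.liftQ _ E₀ hker.ge
  have hE : ∀ F, E (Submodule.Quotient.mk F) = E₀ F := fun F => Submodule.liftQ_apply _ _ _
  refine ⟨E, ?_, fun G hG => ⟨Submodule.Quotient.mk (mulTheta p m ⟨G, hG⟩), by rw [hE, hE₀]⟩,
    ?_, ?_⟩
  · rw [← LinearMap.ker_eq_bot]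
    exact Submodule.ker_liftQ_eq_bot _ _ _ hker.le
  · intro q
    obtain ⟨F, rfl⟩ := Submodule.Quotient.mk_surjective _ q
    obtain ⟨G, rfl⟩ := (mulTheta_bijective m).2 F
    exact ⟨G, G.2, by rw [hE, hE₀]⟩
  · intro g F F' h w
    obtain ⟨G, rfl⟩ := (mulTheta_bijective m).2 F
    have : F' = mulTheta p m (g.det • ⟨matAct p g G, matAct_mem_Vh g G.2⟩) := by
      refine Subtype.ext ?_
      rw [h, coe_mulTheta, coe_mulTheta, map_mul, matAct_theta]
      simp
    rw [this, hE, hE, hE₀, hE₀]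
    simp [eval_matAct, smul_eval]

theorem zmod_pow_add_mul {x : ZMod p} {a : ℕ} (ha : 1 ≤ a) (s : ℕ) :
    x ^ (a + s * (p - 1)) = x ^ a := by
  rcases eq_or_ne x 0 with rfl | hx
  · rw [zero_pow (by omega), zero_pow (by omega)]
  · rw [pow_add, mul_comm s, pow_mul, ZMod.pow_card_sub_one_eq_one hx, one_pow, mul_one]

theorem sum_plane_pow_mul_pow (a b : ℕ) :
    ∑ w : Fin 2 → ZMod p, w 0 ^ a * w 1 ^ b = (∑ x : ZMod p, x ^ a) * ∑ x : ZMod p, x ^ b := by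
  rw [Fintype.sum_mul_sum, ← Fintype.sum_prod_type' (f := fun x y : ZMod p => x ^ a * y ^ b),
    ← (finTwoArrowEquiv (ZMod p)).sum_comp]
  rfl

theorem sum_plane_eq_zero {a b : ℕ} (h : a + b < 2 * (p - 1)) :
    ∑ w : Fin 2 → ZMod p, w 0 ^ a * w 1 ^ b = 0 := by
  rw [sum_plane_pow_mul_pow]
  rcases (by omega : a < p - 1 ∨ b < p - 1) with h | h
  · rw [FiniteField.sum_pow_lt_card_sub_one (ZMod p) a (by rwa [ZMod.card]), zero_mul]
  · rw [FiniteField.sum_pow_lt_card_sub_one (ZMod p) b (by rwa [ZMod.card]), mul_zero]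

/-- The form `w₁ X - w₀ Y`, vanishing at `w`, is linear. -/
theorem isHomogeneous_linForm (w : Fin 2 → ZMod p) :
    (C (w 1) * X 0 - C (w 0) * X 1 : MvPolynomial (Fin 2) (ZMod p)).IsHomogeneous 1 :=
  (isHomogeneous_C_mul_X _ _).sub (isHomogeneous_C_mul_X _ _)

/-- The map `f ↦ ∑ f(w) (w₁ X - w₀ Y)^n` from functions on the plane to `V_n`. -/
noncomputable def planeTransform (p n : ℕ) [Fact p.Prime] : PlaneFun p →ₗ[ZMod p] ↥(Vh p n) :=
  ∑ w : Fin 2 → ZMod p, (LinearMap.proj w : PlaneFun p →ₗ[ZMod p] ZMod p).smulRight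
    ⟨(C (w 1) * X 0 - C (w 0) * X 1) ^ n,
      (mem_homogeneousSubmodule _ _).2 (by simpa using (isHomogeneous_linForm w).pow n)⟩

theorem coe_planeTransform (n : ℕ) (f : PlaneFun p) :
    (planeTransform p n f : MvPolynomial (Fin 2) (ZMod p)) =
      ∑ w : Fin 2 → ZMod p, f w • (C (w 1) * X 0 - C (w 0) * X 1) ^ n := by
  simp [planeTransform]

theorem planeTransform_eq_sum (n : ℕ) (f : PlaneFun p) :
    (planeTransform p n f : MvPolynomial (Fin 2) (ZMod p)) =
      ∑ j ∈ Finset.range (n + 1),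
        ((-1) ^ j * (n.choose j : ZMod p) * ∑ w, f w * (w 0 ^ j * w 1 ^ (n - j))) •
          (X 0 ^ (n - j) * X 1 ^ j) := by
  rw [coe_planeTransform]
  simp_rw [Finset.mul_sum, Finset.sum_smul]
  rw [Finset.sum_comm]
  refine Finset.sum_congr rfl fun w _ => ?_
  rw [sub_eq_neg_add, add_pow, Finset.smul_sum]
  refine Finset.sum_congr rfl fun j _ => ?_
  simp only [smul_eq_C_mul, C_mul, C_pow, C_neg, C_1, mul_pow, map_natCast]
  ring

theorem planeTransform_equivariant {k n : ℕ} (hkn : k + n + 1 = p)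
    {g : Matrix (Fin 2) (Fin 2) (ZMod p)} (hg : IsUnit g) (f : PlaneFun p) :
    (planeTransform p n fun w => g.det * f (Matrix.vecMul w g) : MvPolynomial (Fin 2) (ZMod p)) =
      twAct p (k + 1) g (planeTransform p n f : MvPolynomial (Fin 2) (ZMod p)) := by
  have hbij : Function.Bijective fun w : Fin 2 → ZMod p => Matrix.vecMul w g :=
    Finite.injective_iff_bijective.1 (Matrix.vecMul_injective_of_isUnit hg)
  have hL : ∀ w : Fin 2 → ZMod p,
      matAct p g (C (Matrix.vecMul w g 1) * X 0 - C (Matrix.vecMul w g 0) * X 1) =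
        C g.det * (C (w 1) * X 0 - C (w 0) * X 1) := by
    intro w
    have hC : ∀ a : ZMod p, matAct p g (C a) = C a := fun a => by simp [matAct]
    rw [map_sub, map_mul, map_mul, hC, hC]
    simp only [matAct, aeval_X, Fin.sum_univ_two, Matrix.vecMul, dotProduct, C_add, C_mul,
      Matrix.det_fin_two, C_sub]
    ring
  rw [twAct, coe_planeTransform, coe_planeTransform, map_sum, Finset.smul_sum]
  refine Fintype.sum_bijective _ hbij _ _ fun w => ?_
  rw [map_smul, map_pow, hL, mul_pow, ← C_pow, C_mul' (a := g.det ^ n), smul_smul, smul_smul]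
  congr 1
  have : g.det ^ (k + n + 1) = g.det := by rw [hkn, ZMod.pow_card]
  nth_rewrite 1 [← this]
  ring

theorem planeTransform_eval_eq_zero {k n : ℕ} (hkn : k + n + 1 = p)
    {P : MvPolynomial (Fin 2) (ZMod p)} (hP : P ∈ Vh p k) :
    planeTransform p n (fun w => eval w P) = 0 := by
  have hp := (Fact.out : p.Prime).two_le
  have hle : Vh p k ≤ LinearMap.ker ((planeTransform p n).comp (evalₗ (ZMod p) (Fin 2))) := by
    refine (Vh_le_span k).trans (Submodule.span_le.2 ?_)
    rintro _ ⟨i, j, rfl, rfl⟩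
    refine Subtype.ext ?_
    rw [LinearMap.comp_apply, planeTransform_eq_sum]
    refine Finset.sum_eq_zero fun l hl => ?_
    have hl := Finset.mem_range.1 hl
    have := sum_plane_eq_zero (p := p) (a := i + l) (b := j + (n - l)) (by omega)
    simp_rw [pow_add] at this
    simp only [evalₗ_apply, map_mul, map_pow, eval_X]
    simp_rw [mul_mul_mul_comm (_ ^ i)]
    rw [this]
    simp
  exact hle hP

theorem planeTransform_monomial {k n t : ℕ} (hk : 1 ≤ k) (hkn : k + n + 1 = p) (ht : 1 ≤ t)
    {j : ℕ} (hj : j ≤ n) :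
    (planeTransform p n (fun w => w 0 ^ (p - 1 - j) * w 1 ^ (k + t * (p - 1) - (p - 1 - j))) :
      MvPolynomial (Fin 2) (ZMod p)) =
      ((-1) ^ j * (n.choose j : ZMod p)) • (X 0 ^ (n - j) * X 1 ^ j) := by
  have hp := (Fact.out : p.Prime).two_le
  rw [planeTransform_eq_sum]
  obtain ⟨t, rfl⟩ := Nat.exists_eq_add_of_le' ht
  simp_rw [mul_mul_mul_comm (_ ^ (p - 1 - j)), ← pow_add, sum_plane_pow_mul_pow]
  have he : k + (t + 1) * (p - 1) - (p - 1 - j) = k + t * (p - 1) + j := by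
    rw [add_mul, one_mul]
    omega
  rw [he, Finset.sum_eq_single j]
  · rw [show p - 1 - j + j = p - 1 by omega,
      show k + t * (p - 1) + j + (n - j) = (t + 1) * (p - 1) by rw [add_mul, one_mul]; omega,
      sum_zmod_pow (by omega), sum_zmod_pow (Nat.mul_pos (by omega) (by omega)),
      if_pos dvd_rfl, if_pos (dvd_mul_left _ _)]
    simp
  · intro l hl hlj
    have hl := Finset.mem_range.1 hl
    rw [sum_zmod_pow (N := p - 1 - j + l) (by omega), if_neg, zero_mul, mul_zero, zero_smul]
    rintro ⟨c, hc⟩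
    rcases c with _ | _ | c
    · omega
    · omega
    · rw [show (p - 1) * (c + 1 + 1) = (p - 1) * c + (p - 1) + (p - 1) by ring] at hc
      omega
  · intro h
    exact absurd (Finset.mem_range.2 (by omega)) h

theorem eq_zero_of_sum_smul_monomials {n : ℕ} {a : ℕ → ZMod p}
    (h : ∑ j ∈ Finset.range (n + 1),
      a j • (X 0 ^ (n - j) * X 1 ^ j : MvPolynomial (Fin 2) (ZMod p)) = 0)
    {j : ℕ} (hj : j ≤ n) : a j = 0 := by
  have := congrArg (coeff (Finsupp.single 0 (n - j) + Finsupp.single 1 j)) h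
  simp_rw [X_pow_mul_X_pow_eq_monomial, coeff_sum, coeff_smul, coeff_monomial] at this
  rw [Finset.sum_eq_single j] at this
  · simpa using this
  · intro l _ hlj
    rw [if_neg, smul_zero]
    intro e
    have := DFunLike.congr_fun e 1
    simp at this
    omega
  · intro h
    exact absurd (Finset.mem_range.2 (by omega)) h

theorem zmod_choose_ne_zero {n j : ℕ} (hn : n < p) (hj : j ≤ n) : (n.choose j : ZMod p) ≠ 0 := by
  rw [Ne, ZMod.natCast_eq_zero_iff]
  intro h
  have := (Fact.out : p.Prime).dvd_factorial.1
    ((h.mul_right _).mul_right _ |>.trans (Nat.choose_mul_factorial_mul_factorial hj).dvd)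
  omega

/-- As functions on the plane, the forms of degree `k + t (p - 1)` are combinations of forms of
degree `k` and of monomials whose images under `planeTransform` are independent. -/
theorem exists_eval_eq_add_sum {k n t : ℕ} (hk : 1 ≤ k) (hkn : k + n + 1 = p)
    {G : MvPolynomial (Fin 2) (ZMod p)} (hG : G ∈ Vh p (k + t * (p - 1))) :
    ∃ P ∈ Vh p k, ∃ d : ℕ → ZMod p, (fun w => eval w G) = (fun w => eval w P) +
      ∑ j ∈ Finset.range (n + 1), d j • (fun w : Fin 2 → ZMod p =>
        w 0 ^ (p - 1 - j) * w 1 ^ (k + t * (p - 1) - (p - 1 - j))) := by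
  refine Submodule.span_induction (p := fun G _ => ∃ P ∈ Vh p k, ∃ d : ℕ → ZMod p,
    (fun w => eval w G) = (fun w => eval w P) +
      ∑ j ∈ Finset.range (n + 1), d j • (fun w : Fin 2 → ZMod p =>
        w 0 ^ (p - 1 - j) * w 1 ^ (k + t * (p - 1) - (p - 1 - j)))) ?_
    ⟨0, Submodule.zero_mem _, 0, ?_⟩ ?_ ?_ (Vh_le_span _ hG)
  · rintro _ ⟨i, j, hij, rfl⟩
    rcases Nat.eq_zero_or_pos j with rfl | hj
    · refine ⟨X 0 ^ k * X 1 ^ 0, X_pow_mul_X_pow_mem_Vh k 0, 0, ?_⟩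
      ext w
      rw [add_zero] at hij
      simp [hij, zmod_pow_add_mul hk]
    rcases Nat.eq_zero_or_pos i with rfl | hi
    · refine ⟨X 0 ^ 0 * X 1 ^ k, by simpa using X_pow_mul_X_pow_mem_Vh (p := p) 0 k, 0, ?_⟩
      ext w
      rw [zero_add] at hij
      simp [hij, zmod_pow_add_mul hk]
    obtain ⟨e, s, he1, he2, rfl⟩ : ∃ e s, 1 ≤ e ∧ e ≤ p - 1 ∧ i = e + s * (p - 1) := by
      refine ⟨(i - 1) % (p - 1) + 1, (i - 1) / (p - 1), by omega, ?_, ?_⟩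
      · have := Nat.mod_lt (i - 1) (show p - 1 > 0 by omega)
        omega
      · have := Nat.mod_add_div (i - 1) (p - 1)
        rw [mul_comm] at this
        omega
    rcases Nat.lt_or_ge e k with hek | hek
    · obtain ⟨u, rfl⟩ : ∃ u, t = s + u := by
        refine Nat.exists_eq_add_of_le ?_
        by_contra! hlt
        obtain ⟨u, rfl⟩ := Nat.exists_eq_add_of_lt hlt
        rw [show (t + u + 1) * (p - 1) = t * (p - 1) + u * (p - 1) + (p - 1) by ring] at hij
        omega
      have hj' : j = k - e + u * (p - 1) := by
        rw [add_mul] at hij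
        omega
      refine ⟨X 0 ^ e * X 1 ^ (k - e), ?_, 0, ?_⟩
      · have := X_pow_mul_X_pow_mem_Vh (p := p) e (k - e)
        rwa [Nat.add_sub_cancel' hek.le] at this
      · ext w
        simp [hj', zmod_pow_add_mul he1, zmod_pow_add_mul (show 1 ≤ k - e by omega)]
    · refine ⟨0, Submodule.zero_mem _, Pi.single (p - 1 - e) 1, ?_⟩
      rw [Finset.sum_eq_single (p - 1 - e) (fun x _ hx => by simp [hx])
        (fun h => absurd (Finset.mem_range.2 (by omega)) h)]
      ext w
      rw [show p - 1 - (p - 1 - e) = e by omega,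
        show k + t * (p - 1) - e = j + s * (p - 1) by omega]
      simp [zmod_pow_add_mul he1, zmod_pow_add_mul hj]
  · ext w
    simp
  · rintro x y _ _ ⟨P, hP, d, h⟩ ⟨P', hP', d', h'⟩
    refine ⟨P + P', Submodule.add_mem _ hP hP', d + d', ?_⟩
    have := congrArg₂ (· + ·) h h'
    simp only [Pi.add_apply, add_smul, Finset.sum_add_distrib, map_add] at this ⊢
    exact this.trans (add_add_add_comm _ _ _ _)
  · rintro a x _ ⟨P, hP, d, h⟩
    refine ⟨a • P, Submodule.smul_mem _ _ hP, a • d, ?_⟩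
    have := congrArg (a • ·) h
    simp only [smul_add, Finset.smul_sum, smul_smul] at this
    convert this using 1
    · ext w
      simp [smul_eval]
    · congr 1
      ext w
      simp [smul_eval]

theorem exists_eval_eq_eval {k t : ℕ} (hk : 1 ≤ k)
    {P : MvPolynomial (Fin 2) (ZMod p)} (hP : P ∈ Vh p k) :
    ∃ G ∈ Vh p (k + t * (p - 1)), (fun w => eval w G) = fun w => eval w P := by
  refine Submodule.span_induction (p := fun P _ => ∃ G ∈ Vh p (k + t * (p - 1)),
    (fun w => eval w G) = fun w => eval w P) ?_ ⟨0, Submodule.zero_mem _, by simp⟩ ?_ ?_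
    (Vh_le_span _ hP)
  · rintro _ ⟨i, j, rfl, rfl⟩
    rcases Nat.eq_zero_or_pos i with rfl | hi
    · refine ⟨X 0 ^ 0 * X 1 ^ (j + t * (p - 1)), ?_, ?_⟩
      · convert X_pow_mul_X_pow_mem_Vh (p := p) 0 (j + t * (p - 1)) using 2
        ring
      · ext w
        simp [zmod_pow_add_mul (show 1 ≤ j by omega)]
    · refine ⟨X 0 ^ (i + t * (p - 1)) * X 1 ^ j, ?_, ?_⟩
      · convert X_pow_mul_X_pow_mem_Vh (p := p) (i + t * (p - 1)) j using 2
        ring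
      · ext w
        simp [zmod_pow_add_mul hi]
  · rintro x y _ _ ⟨G, hG, h⟩ ⟨G', hG', h'⟩
    refine ⟨G + G', Submodule.add_mem _ hG hG', ?_⟩
    ext w
    simp [congrFun h w, congrFun h' w]
  · rintro a x _ ⟨G, hG, h⟩
    refine ⟨a • G, Submodule.smul_mem _ _ hG, ?_⟩
    ext w
    simp [smul_eval, congrFun h w]

theorem exists_pow_ne_one {k : ℕ} (hk : 1 ≤ k) (hkp : k < p - 1) :
    ∃ d : ZMod p, d ≠ 0 ∧ d ^ k ≠ 1 := by
  by_contra! h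
  have := (FiniteField.forall_pow_eq_one_iff (ZMod p) k).1 fun x =>
    Units.ext (by rw [Units.val_pow_eq_pow_val, Units.val_one]; exact h x x.ne_zero)
  rw [ZMod.card] at this
  exact absurd (Nat.le_of_dvd hk this) (by omega)

theorem sum_add_C_mul_pow_eq_zero {n : ℕ} (hn : n < p - 1) :
    ∑ c : ZMod p, (X 0 + C c * X 1 : MvPolynomial (Fin 2) (ZMod p)) ^ n = 0 := by
  simp only [add_comm (X 0 : MvPolynomial (Fin 2) (ZMod p)), add_pow]
  rw [Finset.sum_comm]
  refine Finset.sum_eq_zero fun i hi => ?_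
  have hi := Finset.mem_range.1 hi
  simp_rw [mul_pow, mul_assoc, ← Finset.sum_mul, ← C_pow, ← map_sum]
  rw [FiniteField.sum_pow_lt_card_sub_one (ZMod p) i (by rw [ZMod.card]; omega), C_0, zero_mul]

/-- For `n ≥ 1`, `V_n ⊗ D^(k+1)` does not embed equivariantly in the functions on the plane
twisted by `D`. -/
theorem not_injective_of_equivariant {k n : ℕ} (hk : 1 ≤ k) (hn : 1 ≤ n) (hkn : k + n + 1 = p)
    (S : ↥(Vh p n) →ₗ[ZMod p] PlaneFun p)
    (hS : ∀ g : Matrix (Fin 2) (Fin 2) (ZMod p), IsUnit g → ∀ x y : ↥(Vh p n),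
      (y : MvPolynomial (Fin 2) (ZMod p)) =
        twAct p (k + 1) g (x : MvPolynomial (Fin 2) (ZMod p)) →
      ∀ w, S y w = g.det * S x (Matrix.vecMul w g)) :
    ¬ Function.Injective S := by
  intro hinj
  have hX : ∀ c : ZMod p, (X 0 + C c * X 1 : MvPolynomial (Fin 2) (ZMod p)) ^ n ∈ Vh p n := by
    intro c
    refine (mem_homogeneousSubmodule _ _).2 ?_
    simpa using ((isHomogeneous_X (ZMod p) (0 : Fin 2)).add (isHomogeneous_C_mul_X c 1)).pow n
  let x₀ : ↥(Vh p n) := ⟨X 0 ^ n, by simpa using hX 0⟩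
  have hdiag : ∀ d : ZMod p, d ≠ 0 → ∀ u v, d ^ k * S x₀ ![u, v] = S x₀ ![u, d * v] := by
    intro d hd u v
    have h := hS !![1, 0; 0, d] (by rw [Matrix.isUnit_iff_isUnit_det]; simpa using hd) x₀
      (d ^ (k + 1) • x₀) (by simp [x₀, twAct, matAct]) ![u, v]
    rw [map_smul, Pi.smul_apply, smul_eq_mul, pow_succ', mul_assoc] at h
    have e : Matrix.vecMul ![u, v] !![1, 0; 0, d] = ![u, d * v] := by
      ext i; fin_cases i <;> simp [Matrix.vecMul, dotProduct, mul_comm]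
    rw [e, Matrix.det_fin_two_of, one_mul, zero_mul, sub_zero] at h
    exact mul_left_cancel₀ hd h
  have hupper : ∀ b u v : ZMod p, S x₀ ![u, v] = S x₀ ![u, b * u + v] := by
    intro b u v
    have h := hS !![1, b; 0, 1] (by rw [Matrix.isUnit_iff_isUnit_det]; simp) x₀
      x₀ (by simp [x₀, twAct, matAct]) ![u, v]
    have e : Matrix.vecMul ![u, v] !![1, b; 0, 1] = ![u, b * u + v] := by
      ext i; fin_cases i <;> simp [Matrix.vecMul, dotProduct, mul_comm]
    rw [e, Matrix.det_fin_two_of] at h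
    simpa using h
  have hlower : ∀ u v : ZMod p, ∑ c : ZMod p, S x₀ ![u + c * v, v] = 0 := by
    intro u v
    have h : ∀ c : ZMod p, S ⟨_, hX c⟩ ![u, v] = S x₀ ![u + c * v, v] := by
      intro c
      have h := hS !![1, 0; c, 1] (by rw [Matrix.isUnit_iff_isUnit_det]; simp) x₀
        ⟨_, hX c⟩ (by simp [x₀, twAct, matAct]) ![u, v]
      have e : Matrix.vecMul ![u, v] !![1, 0; c, 1] = ![u + c * v, v] := by
        ext i; fin_cases i <;> simp [Matrix.vecMul, dotProduct, mul_comm]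
      rw [e, Matrix.det_fin_two_of] at h
      simpa using h
    have hsum : ∑ c : ZMod p, (⟨_, hX c⟩ : ↥(Vh p n)) = 0 := by
      refine Subtype.ext ?_
      rw [AddSubmonoidClass.coe_finsetSum]
      exact sum_add_C_mul_pow_eq_zero (by omega)
    simp_rw [← h]
    rw [← Finset.sum_apply, ← map_sum, hsum, map_zero, Pi.zero_apply]
  obtain ⟨d, hd, hdk⟩ := exists_pow_ne_one (p := p) hk (by omega)
  have h0 : ∀ u, S x₀ ![u, 0] = 0 := by
    intro u
    have h := hdiag d hd u 0
    rw [mul_zero] at h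
    have : (d ^ k - 1) * S x₀ ![u, 0] = 0 := by rw [sub_mul, h]; ring
    exact (mul_eq_zero.1 this).resolve_left (sub_ne_zero.2 hdk)
  have h1 : ∀ u v, u ≠ 0 → S x₀ ![u, v] = 0 := by
    intro u v hu
    rw [hupper (-v / u) u v, div_mul_cancel₀ _ hu, neg_add_cancel, h0]
  have h2 : ∀ v, S x₀ ![0, v] = 0 := by
    intro v
    rcases eq_or_ne v 0 with rfl | hv
    · exact h0 0
    · have h := hlower 0 v
      rw [Fintype.sum_eq_single 0 fun c hc => h1 _ _ (by simp [hc, hv])] at h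
      simpa using h
  have hz : S x₀ = 0 := by
    ext w
    have hw : w = ![w 0, w 1] := by ext i; fin_cases i <;> rfl
    rw [hw]
    rcases eq_or_ne (w 0) 0 with h | h
    · rw [h, h2]; rfl
    · rw [h1 _ _ h]; rfl
  have := congrArg Subtype.val (hinj (hz.trans (map_zero S).symm))
  exact pow_ne_zero n (X_ne_zero (R := ZMod p) (0 : Fin 2)) this

/-- The function `1 - δ₀` on the plane comes from a form of degree
`p - 1 + t (p - 1)`, for `t ≥ 1`. -/
theorem exists_eval_eq_one_sub_single (hp3 : 3 ≤ p) {t : ℕ} (ht : 1 ≤ t) :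
    ∃ G ∈ Vh p (p - 1 + t * (p - 1)), (fun w => eval w G) = (1 - Pi.single 0 1 : PlaneFun p) := by
  have h1 := X_pow_mul_X_pow_mem_Vh (p := p) (p - 1 + t * (p - 1)) 0
  have h2 := X_pow_mul_X_pow_mem_Vh (p := p) 0 (p - 1 + t * (p - 1))
  rw [zero_add] at h2
  have h3 := X_pow_mul_X_pow_mem_Vh (p := p) (p - 1) (t * (p - 1))
  refine ⟨_, Submodule.sub_mem _ (Submodule.add_mem _ h1 h2) h3, ?_⟩
  have e : ∀ x : ZMod p, x ^ (t * (p - 1)) = x ^ (p - 1) := by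
    intro x
    obtain ⟨t, rfl⟩ := Nat.exists_eq_add_of_le' ht
    rw [add_mul, one_mul, add_comm, zmod_pow_add_mul (by omega)]
  have e0 : ∀ x : ZMod p, x ^ (p - 1) = if x = 0 then 0 else 1 := by
    intro x
    split_ifs with h
    · rw [h, zero_pow (by omega)]
    · exact ZMod.pow_card_sub_one_eq_one h
  ext w
  have hw : w = 0 ↔ w 0 = 0 ∧ w 1 = 0 := by
    simp [funext_iff, Fin.forall_fin_two]
  simp only [map_sub, map_add, map_mul, map_pow, eval_X, pow_zero, mul_one, one_mul,
    zmod_pow_add_mul (show 1 ≤ p - 1 by omega), e, e0, Pi.sub_apply, Pi.one_apply, Pi.single_apply,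
    hw]
  by_cases h0 : w 0 = 0 <;> by_cases h1 : w 1 = 0 <;> simp [h0, h1]

theorem eq_C_of_mem_Vh_zero {x : MvPolynomial (Fin 2) (ZMod p)} (hx : x ∈ Vh p 0) :
    x = C (eval 0 x) := by
  have := totalDegree_eq_zero_iff_eq_C.1 ((totalDegree_zero_iff_isHomogeneous _).2
    ((mem_homogeneousSubmodule _ _).1 hx))
  rw [this]
  simp

theorem twAct_C {N : ℕ} (g : Matrix (Fin 2) (Fin 2) (ZMod p)) (a : ZMod p) :
    twAct p N g (C a) = C (g.det ^ N * a) := by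
  simp [twAct, matAct, smul_eq_C_mul]

theorem planeTransform_one_sub_single :
    (planeTransform p 0 (1 - Pi.single 0 1) : MvPolynomial (Fin 2) (ZMod p)) = -1 := by
  rw [coe_planeTransform]
  simp_rw [pow_zero]
  rw [← Finset.sum_smul]
  simp [sub_eq_add_neg, Finset.sum_add_distrib]

/-- The exact sequence `0 → V_k ⊗ D → V_r^*/V_r^{**} → V_n ⊗ D^(k+1) → 0` for
`k + n = p - 1` and `r = k + t (p - 1) + p + 1`, which splits iff `n = 0`. -/
theorem starSES_of_add_eq {k n t n₂ : ℕ} (hp3 : 3 ≤ p) (hk : 1 ≤ k) (hkn : k + n + 1 = p)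
    (ht : 1 ≤ t) (hn₂ : ∀ d : ZMod p, d ≠ 0 → d ^ n₂ = d ^ (k + 1)) {c : Prop} (hc : c ↔ n = 0) :
    StarSES p (k + t * (p - 1) + p + 1) k 1 n n₂ c := by
  have hm : p ≤ k + t * (p - 1) := by
    have := Nat.mul_le_mul_right (p - 1) ht
    omega
  have htw : ∀ g : Matrix (Fin 2) (Fin 2) (ZMod p), IsUnit g → ∀ F,
      twAct p n₂ g F = twAct p (k + 1) g F := by
    intro g hg F
    rw [twAct, twAct, hn₂ _ ((Matrix.isUnit_iff_isUnit_det g).1 hg).ne_zero]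
  obtain ⟨E, hE, hlift, hrep, hequiv⟩ := exists_starQuot_eval hm
  have hker : LinearMap.ker E = ⊥ := LinearMap.ker_eq_bot.2 hE
  let ev : ↥(Vh p k) →ₗ[ZMod p] PlaneFun p := (evalₗ (ZMod p) (Fin 2)).comp (Vh p k).subtype
  have hev : ∀ x, ev x ∈ LinearMap.range E := by
    intro x
    obtain ⟨G, hG, h⟩ := exists_eval_eq_eval (t := t) hk x.2
    obtain ⟨q, hq⟩ := hlift G hG
    exact ⟨q, hq.trans h⟩
  let ι : ↥(Vh p k) →ₗ[ZMod p] starQuot p (k + t * (p - 1) + p + 1) :=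
    (LinearEquiv.ofInjective E hE).symm.toLinearMap.comp (ev.codRestrict _ hev)
  have hι : ∀ x, E (ι x) = fun w => eval w (x : MvPolynomial (Fin 2) (ZMod p)) := by
    intro x
    exact congrArg Subtype.val ((LinearEquiv.ofInjective E hE).apply_symm_apply ⟨ev x, hev x⟩)
  let π := (planeTransform p n).comp E
  have hchoose : ∀ j ≤ n, (-1 : ZMod p) ^ j * (n.choose j : ZMod p) ≠ 0 := fun j hj =>
    mul_ne_zero (pow_ne_zero _ (neg_ne_zero.2 one_ne_zero)) (zmod_choose_ne_zero (by omega) hj)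
  refine ⟨ι, π, ?_, ?_, ?_, ?_, ?_, ?_⟩
  · intro x y h
    refine Subtype.ext (IsHomogeneous.funext_of_le_card ((mem_homogeneousSubmodule _ _).1 x.2)
      ((mem_homogeneousSubmodule _ _).1 y.2) (fun w => ?_) ?_)
    · exact congrFun ((hι x).symm.trans ((congrArg E h).trans (hι y))) w
    · simp only [Cardinal.mk_fintype, ZMod.card]
      exact_mod_cast (by omega : k ≤ p)
  · have hsurj : ∀ P ∈ Vh p n, ∃ q, (π q : MvPolynomial (Fin 2) (ZMod p)) = P := by
      intro P hP
      suffices h : Vh p n ≤ (LinearMap.range π).map (Vh p n).subtype by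
        obtain ⟨_, ⟨q, rfl⟩, h⟩ := h hP
        exact ⟨q, h⟩
      refine (Vh_le_span n).trans (Submodule.span_le.2 ?_)
      rintro _ ⟨i, j, hij, rfl⟩
      have hexp := Nat.mul_le_mul_right (p - 1) ht
      have hmem := X_pow_mul_X_pow_mem_Vh (p := p) (p - 1 - j) (k + t * (p - 1) - (p - 1 - j))
      rw [show p - 1 - j + (k + t * (p - 1) - (p - 1 - j)) = k + t * (p - 1) by omega] at hmem
      obtain ⟨q, hq⟩ := hlift _ hmem
      have hπ : (π q : MvPolynomial (Fin 2) (ZMod p)) =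
          ((-1) ^ j * (n.choose j : ZMod p)) • (X 0 ^ i * X 1 ^ j) := by
        have := planeTransform_monomial hk hkn ht (show j ≤ n by omega)
        rw [show n - j = i by omega] at this
        rw [← this]
        simp [π, hq]
      rw [SetLike.mem_coe, ← inv_smul_smul₀ (hchoose j (by omega)) (X 0 ^ i * X 1 ^ j), ← hπ]
      exact Submodule.smul_mem _ _ ⟨π q, ⟨q, rfl⟩, rfl⟩
    intro P
    obtain ⟨q, hq⟩ := hsurj P P.2
    exact ⟨q, Subtype.ext hq⟩
  · refine le_antisymm (fun q hq => ?_) ?_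
    · obtain ⟨G, hG, hGq⟩ := hrep q
      obtain ⟨P, hP, d, hd⟩ := exists_eval_eq_add_sum hk hkn hG
      have h0 : (π q : MvPolynomial (Fin 2) (ZMod p)) = 0 := congrArg Subtype.val hq
      have hπ : (π q : MvPolynomial (Fin 2) (ZMod p)) = ∑ j ∈ Finset.range (n + 1),
          (d j * ((-1) ^ j * (n.choose j : ZMod p))) • (X 0 ^ (n - j) * X 1 ^ j) := by
        rw [LinearMap.comp_apply, hGq, hd, map_add, planeTransform_eval_eq_zero hkn hP, zero_add,
          map_sum, AddSubmonoidClass.coe_finsetSum]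
        refine Finset.sum_congr rfl fun j hj => ?_
        rw [map_smul, Submodule.coe_smul, planeTransform_monomial hk hkn ht
          (Nat.lt_succ_iff.1 (Finset.mem_range.1 hj)), smul_smul]
      rw [hπ] at h0
      have hd0 : ∀ j ≤ n, d j = 0 := fun j hj =>
        (mul_eq_zero.1 (eq_zero_of_sum_smul_monomials h0 hj)).resolve_right (hchoose j hj)
      refine ⟨⟨P, hP⟩, hE ?_⟩
      rw [hι, hGq, hd, Finset.sum_eq_zero, add_zero]
      intro j hj
      rw [hd0 j (Nat.lt_succ_iff.1 (Finset.mem_range.1 hj)), zero_smul]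
    · rintro _ ⟨x, rfl⟩
      rw [LinearMap.mem_ker, LinearMap.comp_apply, hι]
      exact planeTransform_eval_eq_zero hkn x.2
  · intro g hg x y F F' hy hF hF'
    refine hE (funext fun w => ?_)
    rw [hequiv g F F' hF', ← hF, hι, hι, hy]
    simp [twAct, smul_eval, eval_matAct]
  · intro g hg F F' hF'
    rw [htw g hg, LinearMap.comp_apply, LinearMap.comp_apply,
      ← planeTransform_equivariant hkn hg]
    congr 2
    exact funext (hequiv g F F' hF')
  · rw [hc]
    constructor
    · rintro ⟨s, hs, hseq⟩
      by_contra hn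
      refine not_injective_of_equivariant hk (Nat.one_le_iff_ne_zero.2 hn) hkn (E.comp s) ?_ ?_
      · intro g hg x y hy w
        obtain ⟨F, hF⟩ := Submodule.Quotient.mk_surjective _ (s x)
        have hmem : matAct p g F ∈ Vstar p (k + t * (p - 1) + p + 1) := by
          refine ⟨matAct_mem_Vh g F.2.1, Ideal.mem_span_singleton.2 ?_⟩
          obtain ⟨q, hq⟩ := Ideal.mem_span_singleton.1 F.2.2
          rw [hq, map_mul, matAct_theta, smul_mul_assoc]
          exact dvd_smul_of_dvd _ (dvd_mul_right _ _)
        have := hseq g hg x y F ⟨_, hmem⟩ (by rw [htw g hg, hy]) hF.symm rfl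
        rw [LinearMap.comp_apply, LinearMap.comp_apply, this, ← hF]
        exact hequiv g F ⟨_, hmem⟩ rfl w
      · have : Function.Injective s :=
          Function.LeftInverse.injective (g := π) fun x => DFunLike.congr_fun hs x
        exact hE.comp this
    · rintro rfl
      obtain rfl : k = p - 1 := by omega
      obtain ⟨G, hG, hGe⟩ := exists_eval_eq_one_sub_single hp3 ht
      obtain ⟨q, hq⟩ := hlift G hG
      rw [hGe] at hq
      let ℓ : ↥(Vh p 0) →ₗ[ZMod p] ZMod p :=
        ((LinearMap.proj 0).comp (evalₗ (ZMod p) (Fin 2))).comp (Vh p 0).subtype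
      have hℓ : ∀ x : ↥(Vh p 0), (x : MvPolynomial (Fin 2) (ZMod p)) = C (ℓ x) := fun x =>
        eq_C_of_mem_Vh_zero x.2
      refine ⟨-ℓ.smulRight q, ?_, ?_⟩
      · refine LinearMap.ext fun x => Subtype.ext ?_
        simp only [LinearMap.comp_apply, LinearMap.neg_apply, LinearMap.smulRight_apply, map_neg,
          map_smul, π, hq, Submodule.coe_neg, Submodule.coe_smul, planeTransform_one_sub_single,
          LinearMap.id_apply]
        rw [hℓ x]
        simp [smul_eq_C_mul]
      · intro g hg x y F F' hy hF hF'
        refine hE (funext fun w => ?_)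
        have hℓy : ℓ y = g.det * ℓ x := by
          rw [hℓ x, hℓ y, htw g hg, twAct_C, hkn, ZMod.pow_card] at hy
          exact C_injective _ _ hy
        have hw : Matrix.vecMul w g = 0 ↔ w = 0 :=
          ⟨fun h => Matrix.vecMul_injective_of_isUnit hg (by simpa using h), fun h => by simp [h]⟩
        rw [hequiv g F F' hF', ← hF]
        simp only [LinearMap.neg_apply, LinearMap.smulRight_apply, map_neg, map_smul, hq, hℓy,
          Pi.neg_apply, Pi.smul_apply, Pi.sub_apply, Pi.one_apply, Pi.single_apply, hw, smul_eq_mul]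
        ring

end Helpers

/-- For a prime `p ≥ 3` and `2p+1 ≤ r` with `r ≡ a mod (p−1)`,
`1 ≤ a ≤ p−1`, there is a short exact sequence of `Γ`-equivariant maps
`0 → V_{p−2} ⊗ D → V_r^*/V_r^{**} → V_1 → 0` if `a = 1`;
`0 → V_{p−1} ⊗ D → V_r^*/V_r^{**} → V_0 ⊗ D → 0` if `a = 2`;
`0 → V_{a−2} ⊗ D → V_r^*/V_r^{**} → V_{p−a+1} ⊗ D^{a−1} → 0` if `3 ≤ a ≤ p−1`;
and these sequences split if and only if `a = 2`. -/
theorem Vstar_mod_Vdstar_ses (p r a : ℕ) (hp : p.Prime) (hp3 : 3 ≤ p)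
    (hr : 2 * p + 1 ≤ r) (ha : 1 ≤ a) (ha2 : a ≤ p - 1) (hmod : r ≡ a [MOD p - 1]) :
    (a = 1 → StarSES p r (p - 2) 1 1 0 (a = 2)) ∧
    (a = 2 → StarSES p r (p - 1) 1 0 1 (a = 2)) ∧
    (3 ≤ a → StarSES p r (a - 2) 1 (p - a + 1) (a - 1) (a = 2)) := by
  have : Fact p.Prime := ⟨hp⟩
  obtain ⟨s, rfl⟩ : ∃ s, r = a + s * (p - 1) := by
    obtain ⟨s, hs⟩ := (Nat.modEq_iff_dvd' (by omega : a ≤ r)).1 hmod.symm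
    exact ⟨s, by rw [mul_comm] at hs; omega⟩
  obtain ⟨m, rfl⟩ : ∃ m, p = m + 1 := ⟨p - 1, by omega⟩
  simp only [Nat.add_sub_cancel] at *
  obtain ⟨s, rfl⟩ : ∃ u, s = u + 2 := by
    refine ⟨s - 2, ?_⟩
    have : 2 ≤ s := by
      by_contra! h
      have := Nat.mul_le_mul_right m (show s ≤ 1 by omega)
      omega
    omega
  have hsm : (s + 2) * m = s * m + 2 * m := by ring
  have hsm1 : (s + 1) * m = s * m + m := by ring
  refine ⟨?_, ?_, fun ha3 => ?_⟩
  · rintro rfl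
    have hs : 1 ≤ s := by
      by_contra! h
      obtain rfl : s = 0 := by omega
      omega
    convert starSES_of_add_eq (p := m + 1) (k := m - 1) (n := 1) (t := s) (n₂ := 0)
      (c := 1 = 2) hp3 (by omega) (by omega) hs (fun d hd => ?_) (by simp) using 1
    · simp only [Nat.add_sub_cancel]
      omega
    · omega
    · rw [show m - 1 + 1 = m + 1 - 1 by omega, ZMod.pow_card_sub_one_eq_one hd, pow_zero]
  · rintro rfl
    have hs : 1 ≤ s := by
      by_contra! h
      obtain rfl : s = 0 := by omega
      omega
    convert starSES_of_add_eq (p := m + 1) (k := m) (n := 0) (t := s) (n₂ := 1)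
      (c := 2 = 2) hp3 (by omega) (by omega) hs (fun d _ => ?_) (by simp) using 1
    · simp only [Nat.add_sub_cancel]
      omega
    · rw [ZMod.pow_card, pow_one]
  · convert starSES_of_add_eq (p := m + 1) (k := a - 2) (n := m + 1 - a + 1) (t := s + 1)
      (n₂ := a - 1) (c := a = 2) hp3 (by omega) (by omega) (by omega) (fun d _ => ?_)
      (by omega) using 1
    · simp only [Nat.add_sub_cancel]
      omega
    · rw [show a - 2 + 1 = a - 1 by omega]
end

section
/- Let p ≥ 3 be a prime and r ≡ 1 mod (p−1) with p | r. Then Σ_{1<j<r, j≡1 mod (p−1)} C(r,j) = Σ_{0<j<r−1, j≡0 mod (p−1)} C(r,j), and this common value is congruent to p − r modulo p². -/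
/-- Reduction of `ZMod (p ^ 2)` modulo `p`. -/
def zmodSqReduce (p : ℕ) : ZMod (p ^ 2) →+* ZMod p :=
  ZMod.castHom (dvd_pow_self p two_ne_zero) (ZMod p)

theorem zmodSq_pow_eq_of_reduce_eq {p : ℕ} {x y : ZMod (p ^ 2)}
    (h : zmodSqReduce p x = zmodSqReduce p y) : x ^ p = y ^ p := by
  obtain ⟨m, rfl⟩ := ZMod.intCast_surjective x
  obtain ⟨n, rfl⟩ := ZMod.intCast_surjective y
  rw [map_intCast, map_intCast, ZMod.intCast_eq_intCast_iff_dvd_sub] at h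
  have h2 : ((p : ℤ) ^ (1 + 1)) ∣ n ^ p ^ 1 - m ^ p ^ 1 := dvd_sub_pow_of_dvd_sub h 1
  rw [pow_one] at h2
  have h3 := (ZMod.intCast_eq_intCast_iff_dvd_sub (m ^ p) (n ^ p) (p ^ 2)).2 (by exact_mod_cast h2)
  exact_mod_cast h3

theorem zmodSqReduce_val {p : ℕ} [Fact p.Prime] (a : ZMod p) :
    zmodSqReduce p (a.val : ZMod (p ^ 2)) = a := by
  rw [map_natCast, ZMod.natCast_zmod_val]

/-- The Teichmüller lift modulo `p ^ 2`. -/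
def teichmullerSq (p : ℕ) [Fact p.Prime] : ZMod p →* ZMod (p ^ 2) where
  toFun a := (a.val : ZMod (p ^ 2)) ^ p
  map_one' := by
    rw [ZMod.val_one, Nat.cast_one, one_pow]
  map_mul' a b := by
    rw [← mul_pow]
    apply zmodSq_pow_eq_of_reduce_eq
    rw [map_mul, zmodSqReduce_val, zmodSqReduce_val, zmodSqReduce_val]

section

variable {p : ℕ} [Fact p.Prime]

theorem teichmullerSq_reduce (x : ZMod (p ^ 2)) :
    teichmullerSq p (zmodSqReduce p x) = x ^ p :=
  zmodSq_pow_eq_of_reduce_eq (zmodSqReduce_val _)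

theorem zmodSqReduce_teichmullerSq (a : ZMod p) : zmodSqReduce p (teichmullerSq p a) = a := by
  change zmodSqReduce p ((a.val : ZMod (p ^ 2)) ^ p) = a
  rw [map_pow, zmodSqReduce_val, ZMod.pow_card]

theorem teichmullerSq_zero : teichmullerSq p 0 = 0 := by
  have h := teichmullerSq_reduce (p := p) 0
  rwa [map_zero, zero_pow (Fact.out : p.Prime).ne_zero] at h

theorem isUnit_of_zmodSqReduce_ne_zero {x : ZMod (p ^ 2)} (h : zmodSqReduce p x ≠ 0) :
    IsUnit x := by
  have h1 := (IsUnit.mk0 _ h).map (teichmullerSq p)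
  rw [teichmullerSq_reduce] at h1
  exact (isUnit_pow_iff (Fact.out : p.Prime).ne_zero).1 h1

theorem sum_teichmullerSq_pow_of_dvd {j : ℕ} (hj : j ≠ 0) (h : p - 1 ∣ j) :
    ∑ a : ZMod p, teichmullerSq p a ^ j = (p : ZMod (p ^ 2)) - 1 := by
  have h1 (a : ZMod p) : teichmullerSq p a ^ j = 1 - if a = 0 then 1 else 0 := by
    split_ifs with ha
    · rw [ha, teichmullerSq_zero, zero_pow hj, sub_self]
    · obtain ⟨k, rfl⟩ := h
      rw [← map_pow, pow_mul, ZMod.pow_card_sub_one_eq_one ha, one_pow, map_one, sub_zero]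
  simp [h1, Finset.sum_sub_distrib, ZMod.card]

theorem sum_teichmullerSq_pow_of_not_dvd {j : ℕ} (h : ¬ p - 1 ∣ j) :
    ∑ a : ZMod p, teichmullerSq p a ^ j = 0 := by
  obtain ⟨g, hg⟩ := IsCyclic.exists_generator (α := (ZMod p)ˣ)
  have hgj : g ^ j ≠ 1 := by
    intro hg1
    apply h
    rw [← ZMod.card_units p, ← Nat.card_eq_fintype_card, ← orderOf_eq_card_of_forall_mem_zpowers hg]
    exact orderOf_dvd_of_pow_eq_one hg1
  have hmul : teichmullerSq p g ^ j * ∑ a : ZMod p, teichmullerSq p a ^ j =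
      ∑ a : ZMod p, teichmullerSq p a ^ j := by
    rw [Finset.mul_sum]
    refine Fintype.sum_equiv (Units.mulLeft g) _ _ fun a => ?_
    rw [Units.mulLeft_apply, map_mul, mul_pow]
  have hunit : IsUnit (teichmullerSq p g ^ j - 1) := by
    apply isUnit_of_zmodSqReduce_ne_zero
    rw [map_sub, map_pow, zmodSqReduce_teichmullerSq, map_one, sub_ne_zero]
    rwa [← Units.val_pow_eq_pow_val, Ne, Units.val_eq_one]
  rw [← hunit.mul_right_eq_zero, sub_mul, one_mul, hmul, sub_self]

theorem one_add_teichmullerSq_pow {r : ℕ} (hr : r ≠ 0) (hmod : r ≡ 1 [MOD p - 1]) (hpr : p ∣ r)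
    (a : ZMod p) : (1 + teichmullerSq p a) ^ r = teichmullerSq p (1 + a) := by
  obtain ⟨k, rfl⟩ := hpr
  have hp : p.Prime := Fact.out
  rw [pow_mul, ← teichmullerSq_reduce, ← map_pow, map_add, map_one, zmodSqReduce_teichmullerSq]
  congr 1
  have hpk : p * k ≡ k [MOD p - 1] := by
    have h : p ≡ 1 [MOD p - 1] := ((Nat.modEq_iff_dvd' hp.one_le).2 dvd_rfl).symm
    simpa using h.mul_right k
  have hk0 : 1 ≤ k := Nat.one_le_iff_ne_zero.2 (by rintro rfl; simp at hr)
  obtain ⟨m, hm⟩ := (Nat.modEq_iff_dvd' hk0).1 (hpk.symm.trans hmod).symm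
  obtain rfl : k = (p - 1) * m + 1 := by omega
  by_cases hb : 1 + a = 0
  · rw [hb, zero_pow (Nat.succ_ne_zero _)]
  · rw [pow_succ, pow_mul, ZMod.pow_card_sub_one_eq_one hb, one_pow, one_mul]

/-- The sum of `C(r, j)` over the positive multiples `j ≤ r` of `p - 1` is `p` modulo `p ^ 2`. -/
theorem sum_choose_multiples_eq {r : ℕ} (hp3 : 3 ≤ p) (hr : r ≠ 0) (hmod : r ≡ 1 [MOD p - 1])
    (hpr : p ∣ r) :
    ∑ j ∈ Finset.Ioc 0 r with p - 1 ∣ j, (r.choose j : ZMod (p ^ 2)) = p := by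
  have hzero : ∑ a : ZMod p, (1 + teichmullerSq p a) ^ r = 0 := by
    simp_rw [one_add_teichmullerSq_pow hr hmod hpr]
    rw [Fintype.sum_equiv (Equiv.addLeft (1 : ZMod p)) (fun a => teichmullerSq p (1 + a))
      (fun a => teichmullerSq p a) fun a => rfl]
    simpa using sum_teichmullerSq_pow_of_not_dvd (p := p) (j := 1)
      (fun h => by have := Nat.le_of_dvd one_pos h; omega)
  have hexpand : ∑ a : ZMod p, (1 + teichmullerSq p a) ^ r =
      p + (∑ j ∈ Finset.Ioc 0 r with p - 1 ∣ j, (r.choose j : ZMod (p ^ 2))) * (p - 1) := by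
    simp_rw [add_comm (1 : ZMod (p ^ 2)), add_pow, one_pow, mul_one]
    rw [Finset.sum_comm, Finset.range_eq_Ico, Finset.sum_eq_sum_Ico_succ_bot (Nat.succ_pos r)]
    congr 1
    · simp [ZMod.card]
    · rw [Finset.sum_mul, Finset.sum_filter]
      refine Finset.sum_congr (by ext; simp; omega) fun j hj => ?_
      rw [← Finset.sum_mul]
      split_ifs with h
      · rw [sum_teichmullerSq_pow_of_dvd (by have := Finset.mem_Ioc.1 hj; omega) h, mul_comm]
      · rw [sum_teichmullerSq_pow_of_not_dvd h, zero_mul]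
  rw [hzero] at hexpand
  have hpp : (p : ZMod (p ^ 2)) ^ 2 = 0 := by exact_mod_cast ZMod.natCast_self (p ^ 2)
  linear_combination (1 + p : ZMod (p ^ 2)) * hexpand +
    (∑ j ∈ Finset.Ioc 0 r with p - 1 ∣ j, (r.choose j : ZMod (p ^ 2)) + 1) * hpp

end


open MvPolynomial

/-- For a prime `p ≥ 3` and `r ≡ 1 mod (p−1)` with `p ∣ r`, one has
`Σ_{1 < j < r, j ≡ 1 mod (p−1)} C(r,j) = Σ_{0 < j < r−1, j ≡ 0 mod (p−1)} C(r,j)`,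
and this common value is congruent to `p − r` modulo `p²`. -/
theorem Sr_cong_modp2 (p r : ℕ) (hp : p.Prime) (hp3 : 3 ≤ p)
    (hmod : r ≡ 1 [MOD p - 1]) (hpr : p ∣ r) :
    (∑ j ∈ Finset.filter (fun j => j % (p - 1) = 1 % (p - 1)) (Finset.Ioo 1 r),
        r.choose j) =
      (∑ j ∈ Finset.filter (fun j => j % (p - 1) = 0) (Finset.Ioo 0 (r - 1)),
        r.choose j) ∧
    ((∑ j ∈ Finset.filter (fun j => j % (p - 1) = 1 % (p - 1)) (Finset.Ioo 1 r),
        r.choose j : ℕ) : ZMod (p ^ 2)) = (p : ZMod (p ^ 2)) - (r : ZMod (p ^ 2)) := by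
  have : Fact p.Prime := ⟨hp⟩
  have hr0 : r ≠ 0 := by
    rintro rfl
    have := (Nat.modEq_iff_dvd' zero_le_one).1 hmod
    have := Nat.le_of_dvd one_pos this
    omega
  have hr : p ≤ r := Nat.le_of_dvd (Nat.pos_of_ne_zero hr0) hpr
  have hdvd : p - 1 ∣ r - 1 := (Nat.modEq_iff_dvd' (by omega)).1 hmod.symm
  have hndvd : ¬ p - 1 ∣ r := fun h => by
    have := (Nat.dvd_sub h hdvd)
    rw [Nat.sub_sub_self (by omega)] at this
    have := Nat.le_of_dvd one_pos this
    omega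
  have hsymm (j : ℕ) (hj : 1 ≤ j) (hjr : j ≤ r) :
      j % (p - 1) = 1 % (p - 1) ↔ (r - j) % (p - 1) = 0 := by
    rw [← Nat.dvd_iff_mod_eq_zero, ← Nat.modEq_iff_dvd' hjr]
    exact ⟨fun h => Nat.ModEq.trans h hmod.symm, fun h => Nat.ModEq.trans h hmod⟩
  have heq : (∑ j ∈ Finset.filter (fun j => j % (p - 1) = 1 % (p - 1)) (Finset.Ioo 1 r),
      r.choose j) =
      ∑ j ∈ Finset.filter (fun j => j % (p - 1) = 0) (Finset.Ioo 0 (r - 1)), r.choose j := by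
    refine Finset.sum_bij' (fun j _ => r - j) (fun j _ => r - j) ?_ ?_ ?_ ?_ ?_
    · intro j hj
      rw [Finset.mem_filter, Finset.mem_Ioo] at hj ⊢
      exact ⟨by omega, (hsymm j (by omega) (by omega)).1 hj.2⟩
    · intro j hj
      rw [Finset.mem_filter, Finset.mem_Ioo] at hj ⊢
      refine ⟨by omega, (hsymm _ (by omega) (by omega)).2 ?_⟩
      rw [Nat.sub_sub_self (by omega)]
      exact hj.2
    · intro j hj
      rw [Finset.mem_filter, Finset.mem_Ioo] at hj
      omega
    · intro j hj
      rw [Finset.mem_filter, Finset.mem_Ioo] at hj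
      omega
    · intro j hj
      rw [Finset.mem_filter, Finset.mem_Ioo] at hj
      exact (Nat.choose_symm (by omega)).symm
  refine ⟨heq, ?_⟩
  rw [heq, eq_sub_iff_add_eq, ← sum_choose_multiples_eq hp3 hr0 hmod hpr]
  have hset : (Finset.Ioc 0 r).filter (fun j => p - 1 ∣ j) =
      insert (r - 1) ((Finset.Ioo 0 (r - 1)).filter (fun j => j % (p - 1) = 0)) := by
    ext j
    simp only [Finset.mem_filter, Finset.mem_insert, Finset.mem_Ioc, Finset.mem_Ioo,
      ← Nat.dvd_iff_mod_eq_zero]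
    constructor
    · rintro ⟨h1, h2⟩
      have : j ≠ r := by rintro rfl; exact hndvd h2
      by_cases h : j = r - 1
      · exact .inl h
      · exact .inr ⟨by omega, h2⟩
    · rintro (rfl | ⟨h1, h2⟩)
      · exact ⟨by omega, hdvd⟩
      · exact ⟨by omega, h2⟩
  rw [hset, Finset.sum_insert (by simp), Nat.choose_symm (by omega), Nat.choose_one_right,
    Nat.cast_sum, add_comm]
end

section
/- Let p ≥ 2 be a prime, p ≤ r with r ≡ 1 mod (p−1), and suppose Σ_p(r−1) = p−1. Then in V_r one has Σ_{k=0}^{p−1} X(kX+Y)^{r−1} = −X^r and Σ_{l=0}^{p−1} (X+lY)^{r−1}Y = −Y^r (identities of polynomials over F_p). As a consequence, dim_{F_p} X_{r−1} ≤ 2p. -/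
open MvPolynomial

theorem digits_sum_modEq (p j : ℕ) (hp : 0 < p) : (Nat.digits p j).sum ≡ j [MOD p - 1] := by
  have h : p ≡ 1 [MOD p - 1] := by
    simpa [Nat.sub_add_cancel hp] using Nat.add_modEq_left (n := p - 1) (a := 1)
  have h' := Nat.ofDigits_modEq' p 1 (p - 1) h (Nat.digits p j)
  rw [Nat.ofDigits_digits, Nat.ofDigits_one] at h'
  exact h'.symm

theorem le_digits_sum (p j : ℕ) (hp : 0 < p) (hj : j ≠ 0) (hdvd : p - 1 ∣ j) :
    p - 1 ≤ (Nat.digits p j).sum := by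
  refine Nat.le_of_dvd (Nat.pos_of_ne_zero fun h => ?_)
    (((digits_sum_modEq p j hp).dvd_iff dvd_rfl).2 hdvd)
  exact Nat.getLast_digit_ne_zero p hj
    (List.sum_eq_zero_iff.1 h _ (List.getLast_mem (Nat.digits_ne_nil_iff_ne_zero.2 hj)))

/-- By Kummer's theorem, `p` divides `n.choose j` when `p - 1` divides both `j` and `n` and the
base-`p` digits of `n` sum to `p - 1`. -/
theorem dvd_choose_of_digits_sum {p n j : ℕ} [hp : Fact p.Prime]
    (hsig : (Nat.digits p n).sum = p - 1) (hn : p - 1 ∣ n) (hj : p - 1 ∣ j)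
    (h0 : j ≠ 0) (hjn : j < n) : p ∣ n.choose j := by
  have hk := sub_one_mul_padicValNat_choose_eq_sub_sum_digits (p := p) hjn.le
  have h1 := le_digits_sum p j hp.out.pos h0 hj
  have h2 := le_digits_sum p (n - j) hp.out.pos (by omega) (Nat.dvd_sub hn hj)
  have h3 := hp.out.two_le
  refine dvd_of_one_le_padicValNat (Nat.one_le_iff_ne_zero.2 fun h => ?_)
  rw [h] at hk
  omega

theorem sum_pow_zmod (p i : ℕ) [Fact p.Prime] (hi : i ≠ 0) :
    ∑ x : ZMod p, x ^ i = if p - 1 ∣ i then -1 else 0 := by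
  have h := FiniteField.sum_pow_units (ZMod p) i
  rw [ZMod.card] at h
  rw [← h, ← Finset.sum_subset (Finset.subset_univ {x : ZMod p | x ≠ 0}) (by simp [hi])]
  symm
  refine Finset.sum_bij (fun (u : (ZMod p)ˣ) _ => (u : ZMod p)) (fun u _ => by simp)
    (fun _ _ _ _ h => Units.ext h) (fun b hb => ?_) (fun _ _ => rfl)
  exact ⟨Units.mk0 b (by simpa using hb), by simp⟩

theorem sum_smul_add_pow {p n : ℕ} [hp : Fact p.Prime] {A : Type*} [CommRing A]
    [Algebra (ZMod p) A] (hsig : (Nat.digits p n).sum = p - 1) (hn : p - 1 ∣ n) (h0 : n ≠ 0)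
    (x y : A) : ∑ k : ZMod p, (algebraMap (ZMod p) A k * x + y) ^ n = -x ^ n := by
  have hcoeff (j : ℕ) (hj : j ∈ Finset.range (n + 1)) (hjn : j ≠ n) :
      (∑ k : ZMod p, k ^ j) * (n.choose j : ZMod p) = 0 := by
    rcases eq_or_ne j 0 with rfl | hj0
    · simp
    rw [sum_pow_zmod p j hj0]
    split_ifs with hd
    · rw [(ZMod.natCast_eq_zero_iff _ _).2
        (dvd_choose_of_digits_sum hsig hn hd hj0 (by rw [Finset.mem_range] at hj; omega)),
        mul_zero]
    · rw [zero_mul]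
  calc ∑ k : ZMod p, (algebraMap (ZMod p) A k * x + y) ^ n
      = ∑ j ∈ Finset.range (n + 1), algebraMap (ZMod p) A
          ((∑ k : ZMod p, k ^ j) * (n.choose j : ZMod p)) * (x ^ j * y ^ (n - j)) := by
        simp_rw [add_pow]
        rw [Finset.sum_comm]
        refine Finset.sum_congr rfl fun j _ => ?_
        rw [map_mul, map_sum, map_natCast, Finset.sum_mul, Finset.sum_mul]
        refine Finset.sum_congr rfl fun k _ => ?_
        rw [mul_pow, map_pow]
        ring
    _ = -x ^ n := by
        rw [Finset.sum_eq_single n (fun j hj hjn => by rw [hcoeff j hj hjn, map_zero, zero_mul])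
          (by simp), sum_pow_zmod p n h0, if_pos hn]
        simp

theorem sum_range_natCast_zmod {M : Type*} [AddCommMonoid M] (p : ℕ) [NeZero p]
    (f : ZMod p → M) : ∑ k ∈ Finset.range p, f k = ∑ k : ZMod p, f k := by
  refine Finset.sum_bij (fun k _ => (k : ZMod p)) (by simp) (fun a ha b hb h => ?_)
    (fun b _ => ⟨b.val, by simp [ZMod.val_lt]⟩) (by simp)
  rw [Finset.mem_range] at ha hb
  rw [← ZMod.val_cast_of_lt ha, h, ZMod.val_cast_of_lt hb]

theorem matAct_monomial (p n : ℕ) (g : Matrix (Fin 2) (Fin 2) (ZMod p)) :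
    matAct p g (X 0 ^ n * X 1) =
      (C (g 0 0) * X 0 + C (g 1 0) * X 1) ^ n * (C (g 0 1) * X 0 + C (g 1 1) * X 1) := by
  simp [matAct, Fin.sum_univ_two]

/-- `L ^ n * X i` as `L` runs over the linear forms `k X + Y`. -/
noncomputable def linPowMul (p n : ℕ) (a : ZMod p × Fin 2) : MvPolynomial (Fin 2) (ZMod p) :=
  (C a.1 * X 0 + X 1) ^ n * X a.2

theorem X_zero_pow_mul_mem_span {p n : ℕ} [hp : Fact p.Prime]
    (hsig : (Nat.digits p n).sum = p - 1) (hn : p - 1 ∣ n) (h0 : n ≠ 0) (i : Fin 2) :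
    X 0 ^ n * X i ∈ Submodule.span (ZMod p) (Set.range (linPowMul p n)) := by
  have hmem (k : ZMod p) (i : Fin 2) : (C k * X 0 + X 1) ^ n * X i ∈
      Submodule.span (ZMod p) (Set.range (linPowMul p n)) :=
    Submodule.subset_span ⟨(k, i), rfl⟩
  fin_cases i
  · have h := sum_smul_add_pow (A := MvPolynomial (Fin 2) (ZMod p)) hsig hn h0 (X 0) (X 1)
    have h' : (X 0 ^ n * X 0 : MvPolynomial (Fin 2) (ZMod p)) =
        -∑ k : ZMod p, (C k * X 0 + X 1) ^ n * X 0 := by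
      rw [← Finset.sum_mul, ← algebraMap_eq, h]
      ring
    exact h' ▸ neg_mem (sum_mem fun k _ => hmem k 0)
  · have h := sum_smul_add_pow (A := MvPolynomial (Fin 2) (ZMod p)) hsig hn h0 (X 1) (X 0)
    rw [← Finset.add_sum_erase _ _ (Finset.mem_univ 0), map_zero, zero_mul, zero_add,
      algebraMap_eq] at h
    have h' : (X 0 ^ n * X 1 : MvPolynomial (Fin 2) (ZMod p)) =
        -((C 0 * X 0 + X 1) ^ n * X 1) -
          ∑ k ∈ Finset.univ.erase (0 : ZMod p), (C k * X 1 + X 0) ^ n * X 1 := by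
      rw [← Finset.sum_mul, eq_sub_of_add_eq h, map_zero]
      ring
    refine h' ▸ sub_mem (neg_mem (hmem 0 1)) (sum_mem fun k hk => ?_)
    have hk0 : k ≠ 0 := Finset.ne_of_mem_erase hk
    have hscale : (C k * X 1 + X 0 : MvPolynomial (Fin 2) (ZMod p)) =
        C k * (C k⁻¹ * X 0 + X 1) := by
      rw [mul_add, ← mul_assoc, ← C_mul, mul_inv_cancel₀ hk0, C_1]
      ring
    rw [hscale, mul_pow, mul_assoc, ← C_pow, C_mul']
    exact Submodule.smul_mem _ _ (hmem _ 1)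

theorem Xr1Sub_le_span {p r : ℕ} [hp : Fact p.Prime]
    (hsig : (Nat.digits p (r - 1)).sum = p - 1) (hn : p - 1 ∣ r - 1) (h0 : r - 1 ≠ 0) :
    Xr1Sub p r ≤ Submodule.span (ZMod p) (Set.range (linPowMul p (r - 1))) := by
  rw [Xr1Sub, Submodule.span_le]
  rintro _ ⟨g, rfl⟩
  have hlin (L : MvPolynomial (Fin 2) (ZMod p)) (c a b : ZMod p)
      (hL : ∀ i, L ^ (r - 1) * X i ∈
        Submodule.span (ZMod p) (Set.range (linPowMul p (r - 1)))) :
      (C c * L) ^ (r - 1) * (C a * X 0 + C b * X 1) ∈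
        Submodule.span (ZMod p) (Set.range (linPowMul p (r - 1))) := by
    have h : (C c * L) ^ (r - 1) * (C a * X 0 + C b * X 1) =
        (c ^ (r - 1) * a) • (L ^ (r - 1) * X 0) + (c ^ (r - 1) * b) • (L ^ (r - 1) * X 1) := by
      simp only [← C_mul', C_mul, C_pow]
      ring
    exact h ▸ add_mem (Submodule.smul_mem _ _ (hL 0)) (Submodule.smul_mem _ _ (hL 1))
  simp only [SetLike.mem_coe, matAct_monomial]
  by_cases hc : g 1 0 = 0
  · rw [hc, C_0, zero_mul, add_zero]
    exact hlin _ _ _ _ (X_zero_pow_mul_mem_span hsig hn h0)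
  · have hscale : (C (g 0 0) * X 0 + C (g 1 0) * X 1 : MvPolynomial (Fin 2) (ZMod p)) =
        C (g 1 0) * (C (g 0 0 / g 1 0) * X 0 + X 1) := by
      rw [mul_add, ← mul_assoc, ← C_mul, mul_div_cancel₀ _ hc]
    rw [hscale]
    exact hlin _ _ _ _ fun i => Submodule.subset_span ⟨(g 0 0 / g 1 0, i), rfl⟩

/-- For a prime `p`, `p ≤ r` with `r ≡ 1 mod (p−1)` and
`Σ_p(r−1) = p−1`, one has `Σ_{k=0}^{p−1} X (kX+Y)^{r−1} = −X^r` and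
`Σ_{l=0}^{p−1} (X+lY)^{r−1} Y = −Y^r` in `V_r`; consequently `dim X_{r−1} ≤ 2p`. -/
theorem relation_sum (p r : ℕ) (hp : p.Prime) (hpr : p ≤ r)
    (hmod : r ≡ 1 [MOD p - 1]) (hsig : (Nat.digits p (r - 1)).sum = p - 1) :
    ((∑ k ∈ Finset.range p,
        X 0 * (C ((k : ZMod p)) * X 0 + X 1) ^ (r - 1) :
          MvPolynomial (Fin 2) (ZMod p)) = -(X 0 ^ r)) ∧
    ((∑ l ∈ Finset.range p,
        (X 0 + C ((l : ZMod p)) * X 1) ^ (r - 1) * X 1 :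
          MvPolynomial (Fin 2) (ZMod p)) = -(X 1 ^ r)) ∧
    Module.finrank (ZMod p) ↥(Xr1Sub p r) ≤ 2 * p := by
  have : Fact p.Prime := ⟨hp⟩
  have h2 := hp.two_le
  have h0 : r - 1 ≠ 0 := by omega
  have hn : p - 1 ∣ r - 1 := (Nat.modEq_iff_dvd' (by omega)).1 hmod.symm
  have hrel (x y : MvPolynomial (Fin 2) (ZMod p)) :
      ∑ k ∈ Finset.range p, (C (k : ZMod p) * x + y) ^ (r - 1) = -x ^ (r - 1) := by
    rw [sum_range_natCast_zmod p fun k => (C k * x + y) ^ (r - 1)]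
    exact sum_smul_add_pow hsig hn h0 x y
  have hr : r - 1 + 1 = r := by omega
  refine ⟨?_, ?_, ?_⟩
  · rw [← Finset.mul_sum, hrel, mul_neg, ← pow_succ', hr]
  · simp_rw [add_comm (X 0 : MvPolynomial (Fin 2) (ZMod p))]
    rw [← Finset.sum_mul, hrel, neg_mul, ← pow_succ, hr]
  · have hfin := Module.Finite.span_of_finite (ZMod p) (Set.finite_range (linPowMul p (r - 1)))
    calc Module.finrank (ZMod p) ↥(Xr1Sub p r)
        ≤ Module.finrank (ZMod p)
            ↥(Submodule.span (ZMod p) (Set.range (linPowMul p (r - 1)))) :=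
          Submodule.finrank_mono (Xr1Sub_le_span hsig hn h0)
      _ ≤ Fintype.card (ZMod p × Fin 2) := finrank_range_le_card _
      _ = 2 * p := by rw [Fintype.card_prod, ZMod.card, Fintype.card_fin, mul_comm]
end

section
/- Let p ≥ 2 be a prime, r ≥ 2p+1 an integer with p ∤ r. If Σ_p(r−1) ≥ p, then dim_{F_p} X_{r−1} = 2p + 2; equivalently, the 2p+2 polynomials X^r, Y^r, X(kX+Y)^{r−1} and (X+lY)^{r−1}Y for k, l ∈ F_p are linearly independent over F_p. -/
open MvPolynomial

theorem Nat.digits_sum_add_mul {p a : ℕ} (hp : 1 < p) (ha : a < p) (m : ℕ) :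
    (Nat.digits p (a + p * m)).sum = a + (Nat.digits p m).sum := by
  by_cases h : a ≠ 0 ∨ m ≠ 0
  · simp [Nat.digits_add p hp a m ha h]
  · push Not at h
    simp [h.1, h.2]

theorem Nat.Prime.not_dvd_choose_of_lt {p a b : ℕ} (hp : p.Prime) (ha : a < p) (hb : b ≤ a) :
    ¬ p ∣ a.choose b := fun h =>
  ha.not_ge <| hp.dvd_factorial.1 <| Nat.choose_mul_factorial_mul_factorial hb ▸
    (h.mul_right _).mul_right _

theorem Nat.Prime.not_dvd_choose_add_mul {p a b m v : ℕ} (hp : p.Prime) (ha : a < p) (hb : b ≤ a)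
    (hv : ¬ p ∣ m.choose v) : ¬ p ∣ (a + p * m).choose (b + p * v) := by
  have := Fact.mk hp
  have hlucas := Choose.choose_modEq_choose_mod_mul_choose_div_nat
    (p := p) (n := a + p * m) (k := b + p * v)
  rw [Nat.add_mul_mod_self_left, Nat.add_mul_mod_self_left, Nat.add_mul_div_left _ _ hp.pos,
    Nat.add_mul_div_left _ _ hp.pos, Nat.mod_eq_of_lt ha, Nat.mod_eq_of_lt (hb.trans_lt ha),
    Nat.div_eq_of_lt ha, Nat.div_eq_of_lt (hb.trans_lt ha), zero_add, zero_add] at hlucas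
  rw [hlucas.dvd_iff dvd_rfl, hp.dvd_mul]
  exact not_or.2 ⟨hp.not_dvd_choose_of_lt ha hb, hv⟩

/-- Every value up to the digit sum of `n` is the digit sum of some `v` such that
`n.choose v` is prime to `p`. -/
theorem Nat.Prime.exists_digits_sum_eq_not_dvd_choose {p : ℕ} (hp : p.Prime) (n : ℕ) :
    ∀ t ≤ (Nat.digits p n).sum,
      ∃ v ≤ n, (Nat.digits p v).sum = t ∧ ¬ p ∣ n.choose v := by
  induction n using Nat.strong_induction_on with
  | _ n ih =>
    intro t ht
    rcases Nat.eq_zero_or_pos n with rfl | hn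
    · exact ⟨0, le_rfl, by simpa using ht.antisymm' (by simp), by simpa using hp.one_lt.ne'⟩
    obtain ⟨a, m, ha, rfl⟩ : ∃ a m, a < p ∧ n = a + p * m :=
      ⟨n % p, n / p, Nat.mod_lt _ hp.pos, (Nat.mod_add_div n p).symm⟩
    have hm : m < a + p * m := by
      rcases Nat.eq_zero_or_pos m with rfl | h
      · exact hn
      · nlinarith [hp.two_le]
    rw [Nat.digits_sum_add_mul hp.one_lt ha] at ht
    by_cases htm : t ≤ (Nat.digits p m).sum
    · obtain ⟨v, hvm, hv, hc⟩ := ih m hm t htm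
      refine ⟨0 + p * v, ?_, ?_, hp.not_dvd_choose_add_mul ha (Nat.zero_le a) hc⟩
      · exact Nat.add_le_add (Nat.zero_le a) (Nat.mul_le_mul_left p hvm)
      · rw [Nat.digits_sum_add_mul hp.one_lt hp.pos, hv, zero_add]
    · refine ⟨t - (Nat.digits p m).sum + p * m, by omega, ?_,
        hp.not_dvd_choose_add_mul ha (by omega) ?_⟩
      · rw [Nat.digits_sum_add_mul hp.one_lt (by omega)]
        omega
      · simpa using hp.one_lt.ne'

theorem Nat.Prime.exists_modEq_mod_eq_not_dvd_choose {p a m u t : ℕ} (hp : p.Prime) (ha : a < p)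
    (hu : u ≤ a) (ht : 1 ≤ t) (htm : t < (Nat.digits p m).sum) :
    ∃ j, 2 ≤ j ∧ j + 2 ≤ a + p * m ∧ j ≡ u + t [MOD p - 1] ∧ j % p = u ∧
      ¬ p ∣ (a + p * m).choose j := by
  obtain ⟨v, hvm, hv, hc⟩ := hp.exists_digits_sum_eq_not_dvd_choose m t htm.le
  have hv0 : v ≠ 0 := by
    rintro rfl
    simp at hv
    omega
  have hvm' : v ≠ m := by
    rintro rfl
    omega
  have hp2 := hp.two_le
  have hpv : p * 1 ≤ p * v := Nat.mul_le_mul_left p (by omega)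
  have hpm : p * (v + 1) ≤ p * m := Nat.mul_le_mul_left p (by omega)
  rw [mul_add] at hpm
  refine ⟨u + p * v, by omega, by omega, Nat.ModEq.add_left u ?_, ?_,
    hp.not_dvd_choose_add_mul ha hu hc⟩
  · have hp1 : p ≡ 1 [MOD p - 1] := ((Nat.modEq_iff_dvd' (by omega)).2 dvd_rfl).symm
    have h1 : p * v ≡ 1 * v [MOD p - 1] := hp1.mul_right v
    have h2 := Nat.ofDigits_modEq' p 1 (p - 1) hp1 (Nat.digits p v)
    rw [Nat.ofDigits_digits, Nat.ofDigits_one, hv] at h2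
    rw [one_mul] at h1
    exact h1.trans h2
  · rw [Nat.add_mul_mod_self_left, Nat.mod_eq_of_lt (by omega)]

/-- If the base-`p` digit sum of `r` exceeds `p` and `p ∤ r`, each residue class modulo `p - 1`
contains two positions in the interior of the `r`-th row of Pascal's triangle which are incongruent
modulo `p` and at which the binomial coefficient is prime to `p`. -/
theorem Nat.Prime.exists_pair_not_dvd_choose {p r : ℕ} (hp : p.Prime) (hpr : ¬ p ∣ r)
    (hsig : p ≤ (Nat.digits p (r - 1)).sum) (n : ℕ) :
    ∃ i j, (2 ≤ i ∧ i + 2 ≤ r ∧ i ≡ n [MOD p - 1] ∧ ¬ p ∣ r.choose i) ∧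
      (2 ≤ j ∧ j + 2 ≤ r ∧ j ≡ n [MOD p - 1] ∧ ¬ p ∣ r.choose j) ∧ i % p ≠ j % p := by
  have hp2 := hp.two_le
  obtain ⟨a, m, ha, rfl⟩ : ∃ a m, a < p ∧ r = a + p * m :=
    ⟨r % p, r / p, Nat.mod_lt _ hp.pos, (Nat.mod_add_div r p).symm⟩
  have ha0 : a ≠ 0 := by
    rintro rfl
    simp at hpr
  rw [show a + p * m - 1 = (a - 1) + p * m by omega,
    Nat.digits_sum_add_mul hp.one_lt (by omega)] at hsig
  have hm : m ≠ 0 := by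
    rintro rfl
    simp at hsig
    omega
  obtain ⟨N, hN1, hNp, hN⟩ : ∃ N, 1 ≤ N ∧ N ≤ p - 1 ∧ N ≡ n [MOD p - 1] := by
    by_cases h : n % (p - 1) = 0
    · exact ⟨p - 1, by omega, le_rfl, by simp [Nat.ModEq, h]⟩
    · exact ⟨n % (p - 1), by omega, (Nat.mod_lt _ (by omega)).le, Nat.mod_modEq _ _⟩
  have key (u t : ℕ) (hu : u ≤ a) (ht : 1 ≤ t) (htm : t < (Nat.digits p m).sum)
      (hut : u + t ≡ n [MOD p - 1]) : ∃ j, (2 ≤ j ∧ j + 2 ≤ a + p * m ∧ j ≡ n [MOD p - 1] ∧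
        ¬ p ∣ (a + p * m).choose j) ∧ j % p = u := by
    obtain ⟨j, h1, h2, h3, h4, h5⟩ := hp.exists_modEq_mod_eq_not_dvd_choose ha hu ht htm
    exact ⟨j, ⟨h1, h2, h3.trans hut, h5⟩, h4⟩
  rcases hN1.eq_or_lt with rfl | hN2
  · obtain ⟨i, hi, hiu⟩ := key 0 1 (by omega) le_rfl (by omega) (by simpa using hN)
    obtain ⟨j, hj, hju⟩ := key a (p - a) le_rfl (by omega) (by omega) (by
      rw [show a + (p - a) = p by omega]
      exact ((Nat.modEq_iff_dvd' (by omega)).2 dvd_rfl).symm.trans hN)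
    exact ⟨i, j, hi, hj, by omega⟩
  by_cases hNa : N ≤ a
  · obtain ⟨i, hi, hiu⟩ := key (N - 1) 1 (by omega) le_rfl (by omega) (by
      rwa [Nat.sub_add_cancel hN1])
    have hpm : p * 1 ≤ p * m := Nat.mul_le_mul_left p (by omega)
    refine ⟨i, N, hi, ⟨hN2, by omega, hN, ?_⟩, ?_⟩
    · simpa using hp.not_dvd_choose_add_mul (m := m) (v := 0) ha hNa (by simpa using hp.one_lt.ne')
    · rw [hiu, Nat.mod_eq_of_lt (by omega)]
      omega
  · obtain ⟨i, hi, hiu⟩ := key a (N - a) le_rfl (by omega) (by omega) (by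
      rwa [show a + (N - a) = N by omega])
    obtain ⟨j, hj, hju⟩ := key (a - 1) (N - a + 1) (by omega) (by omega) (by omega) (by
      rwa [show a - 1 + (N - a + 1) = N by omega])
    exact ⟨i, j, hi, hj, by omega⟩

/-- A function on a finite field all of whose power moments vanish is zero. -/
theorem eq_zero_of_forall_sum_mul_pow_eq_zero {K : Type*} [Field K] [Fintype K] {c : K → K}
    (h : ∀ m, ∑ k, c k * k ^ m = 0) (k₀ : K) : c k₀ = 0 := by
  classical
  have hpoly (f : Polynomial K) : ∑ k, c k * f.eval k = 0 := by
    simp_rw [Polynomial.eval_eq_sum_range, Finset.mul_sum]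
    rw [Finset.sum_comm]
    refine Finset.sum_eq_zero fun i _ => ?_
    simp_rw [mul_left_comm (c _), ← Finset.mul_sum, h, mul_zero]
  have := hpoly (Lagrange.basis Finset.univ id k₀)
  rw [Finset.sum_eq_single k₀] at this
  · have h1 := Lagrange.eval_basis_self (s := (Finset.univ : Finset K)) (v := id)
      Function.injective_id.injOn (Finset.mem_univ k₀)
    simp only [id] at h1
    rwa [h1, mul_one] at this
  · intro k _ hk
    have h1 := Lagrange.eval_basis_of_ne (s := (Finset.univ : Finset K)) (v := id) hk.symm
      (Finset.mem_univ k)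
    simp only [id] at h1
    rw [h1, mul_zero]
  · simp

theorem ZMod.sum_mul_pow_eq_of_modEq {p : ℕ} [Fact p.Prime] (c : ZMod p → ZMod p) {m n : ℕ}
    (hm : m ≠ 0) (hn : n ≠ 0) (h : m ≡ n [MOD p - 1]) :
    ∑ k, c k * k ^ m = ∑ k, c k * k ^ n := by
  refine Finset.sum_congr rfl fun k _ => ?_
  rcases eq_or_ne k 0 with rfl | hk
  · simp [hm, hn]
  · congr 1
    have hk1 := ZMod.pow_card_sub_one_eq_one hk
    rw [← Nat.mod_add_div m (p - 1), ← Nat.mod_add_div n (p - 1), h]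
    simp [pow_add, pow_mul, hk1]

namespace Polynomial

variable {p s : ℕ} {a b : ZMod p} {c d : ZMod p → ZMod p}

/-- The dehomogenization of a linear combination of the generators of `Xr1Sub p (s + 1)`. -/
noncomputable def dehomogenizedCombination (p s : ℕ) [NeZero p] (a b : ZMod p)
    (c d : ZMod p → ZMod p) : (ZMod p)[X] :=
  C a + C b * X ^ (s + 1) + ∑ k, C (c k) * (X + C k) ^ s
    + ∑ l, C (d l) * ((1 + C l * X) ^ s * X)

theorem coeff_zero_dehomogenizedCombination [NeZero p] :
    (dehomogenizedCombination p s a b c d).coeff 0 = a + ∑ k, c k * k ^ s := by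
  simp only [dehomogenizedCombination, coeff_add, finsetSum_coeff,
    coeff_X_add_C_pow, coeff_X_pow, coeff_C_zero, mul_coeff_zero, coeff_X_zero]
  simp

theorem coeff_succ_dehomogenizedCombination [NeZero p] (j : ℕ) :
    (dehomogenizedCombination p s a b c d).coeff (j + 1) =
      (if j = s then b else 0) + s.choose (j + 1) * ∑ k, c k * k ^ (s - (j + 1))
        + s.choose j * ∑ l, d l * l ^ j := by
  have hcomp (l : ZMod p) : (1 + C l * X) ^ s = ((1 + X) ^ s : (ZMod p)[X]).comp (C l * X) := by
    simp
  simp only [dehomogenizedCombination, hcomp, coeff_add, finsetSum_coeff, coeff_C_mul,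
    coeff_X_add_C_pow, coeff_mul_X, comp_C_mul_X_coeff, coeff_one_add_X_pow, coeff_C_succ,
    coeff_X_pow]
  simp only [Finset.mul_sum, zero_add, mul_ite, mul_one, mul_zero, add_left_inj]
  congr 1
  · congr 1
    exact Finset.sum_congr rfl fun _ _ => by ring
  · exact Finset.sum_congr rfl fun _ _ => by ring

section Vanishing

variable [Fact p.Prime] (h : dehomogenizedCombination p s a b c d = 0)
include h

theorem interior_relation {j : ℕ} (hj1 : 1 ≤ j) (hjs : j ≤ s) (hj : ¬ p ∣ (s + 1).choose j) :
    ((s + 1 : ZMod p) - j) * ∑ k, c k * k ^ (s - j) + j * ∑ l, d l * l ^ (j - 1) = 0 := by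
  obtain ⟨j, rfl⟩ := Nat.exists_eq_add_of_le' hj1
  have h0 := congrArg (fun f => f.coeff (j + 1)) h
  simp only [coeff_succ_dehomogenizedCombination, coeff_zero, if_neg (show j ≠ s by omega)] at h0
  have h1 := congrArg (Nat.cast (R := ZMod p)) (Nat.choose_mul_succ_eq s (j + 1))
  have h2 := congrArg (Nat.cast (R := ZMod p)) (Nat.add_one_mul_choose_eq s j)
  rw [← CharP.cast_eq_zero_iff (ZMod p)] at hj
  push_cast [Nat.cast_sub (show j ≤ s by omega)] at h1 h2 ⊢
  refine (mul_eq_zero.1 ?_).resolve_left hj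
  linear_combination (s + 1 : ZMod p) * h0 - (∑ k, c k * k ^ (s - (j + 1))) * h1
    - (∑ l, d l * l ^ j) * h2

variable (hps : ¬ p ∣ s + 1) (hsig : p ≤ (Nat.digits p s).sum)
include hps hsig

theorem exists_moments_eq_zero (n : ℕ) :
    ∃ j, 2 ≤ j ∧ j < s ∧ j ≡ n [MOD p - 1] ∧ ∑ k, c k * k ^ (s - j) = 0 ∧
      ∑ l, d l * l ^ (j - 1) = 0 := by
  have hp : p.Prime := Fact.out
  obtain ⟨i, j, ⟨hi2, his, hin, hi⟩, ⟨hj2, hjs, hjn, hj⟩, hij⟩ :=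
    hp.exists_pair_not_dvd_choose hps hsig n
  have hijn : i ≡ j [MOD p - 1] := hin.trans hjn.symm
  have hri := interior_relation h (by omega) (by omega) hi
  have hrj := interior_relation h (by omega) (by omega) hj
  rw [ZMod.sum_mul_pow_eq_of_modEq c (m := s - i) (n := s - j) (by omega) (by omega)
      (Nat.ModEq.add_right_cancel hijn (by
        rw [Nat.sub_add_cancel (by omega), Nat.sub_add_cancel (by omega)])),
    ZMod.sum_mul_pow_eq_of_modEq d (m := i - 1) (n := j - 1) (by omega) (by omega)
      (Nat.ModEq.add_right_cancel' 1 (by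
        rwa [Nat.sub_add_cancel (by omega), Nat.sub_add_cancel (by omega)]))] at hri
  have hs0 : (s + 1 : ZMod p) ≠ 0 := by
    rw [← CharP.cast_eq_zero_iff (ZMod p)] at hps
    exact_mod_cast hps
  have hij0 : (i - j : ZMod p) ≠ 0 := by
    rw [sub_ne_zero, Ne, ZMod.natCast_eq_natCast_iff]
    exact hij
  have hdet := mul_ne_zero hs0 hij0
  refine ⟨j, hj2, by omega, hjn, (mul_eq_zero.1 ?_).resolve_left hdet,
    (mul_eq_zero.1 ?_).resolve_left hdet⟩
  · linear_combination (i : ZMod p) * hrj - (j : ZMod p) * hri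
  · linear_combination (s + 1 - j : ZMod p) * hri - (s + 1 - i : ZMod p) * hrj

theorem coefficients_eq_zero : a = 0 ∧ b = 0 ∧ c = 0 ∧ d = 0 := by
  have hp2 : 2 ≤ p := (Fact.out : p.Prime).two_le
  have hc (m : ℕ) (hm : m ≠ 0) : ∑ k, c k * k ^ m = 0 := by
    obtain ⟨j, hj2, hjs, hjn, hj, -⟩ := exists_moments_eq_zero h hps hsig (s + m * (p - 2))
    rw [← hj]
    refine ZMod.sum_mul_pow_eq_of_modEq c hm (by omega) (Nat.ModEq.add_right_cancel' j ?_)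
    rw [Nat.sub_add_cancel hjs.le]
    refine (hjn.add_left m).trans ?_
    rw [show m + (s + m * (p - 2)) = s + m * (p - 1) by
      rw [show p - 1 = p - 2 + 1 by omega]; ring]
    simp [Nat.ModEq]
  have hd (m : ℕ) (hm : m ≠ 0) : ∑ l, d l * l ^ m = 0 := by
    obtain ⟨j, hj2, hjs, hjn, -, hj⟩ := exists_moments_eq_zero h hps hsig (m + 1)
    rw [← hj]
    refine ZMod.sum_mul_pow_eq_of_modEq d hm (by omega) (Nat.ModEq.add_right_cancel' 1 ?_)
    rw [Nat.sub_add_cancel (by omega)]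
    exact hjn.symm
  obtain ⟨j, hj2, hjs, -⟩ := exists_moments_eq_zero h hps hsig 0
  have hcoeff (i : ℕ) := congrArg (fun f => f.coeff i) h
  have hc0 : ∑ k, c k * k ^ 0 = 0 := by
    have := hcoeff (s - 1 + 1)
    simp only [coeff_succ_dehomogenizedCombination, coeff_zero] at this
    rw [if_neg (by omega), hd _ (by omega), Nat.sub_add_cancel (by omega)] at this
    simpa using this
  have hd0 : ∑ l, d l * l ^ 0 = 0 := by
    have := hcoeff (0 + 1)
    simp only [coeff_succ_dehomogenizedCombination, coeff_zero] at this
    rw [if_neg (by omega), hc _ (by omega)] at this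
    simpa using this
  have ha := hcoeff 0
  simp only [coeff_zero_dehomogenizedCombination, coeff_zero, hc s (by omega), add_zero] at ha
  have hb := hcoeff (s + 1)
  simp only [coeff_succ_dehomogenizedCombination, coeff_zero, hd s (by omega), if_true,
    Nat.choose_succ_self, Nat.cast_zero, zero_mul, mul_zero, add_zero] at hb
  refine ⟨ha, hb, ?_, ?_⟩
  · ext k
    refine eq_zero_of_forall_sum_mul_pow_eq_zero (fun m => ?_) k
    rcases eq_or_ne m 0 with rfl | hm
    exacts [hc0, hc m hm]
  · ext l
    refine eq_zero_of_forall_sum_mul_pow_eq_zero (fun m => ?_) l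
    rcases eq_or_ne m 0 with rfl | hm
    exacts [hd0, hd m hm]

end Vanishing

end Polynomial

/-- The generators `X^r, Y^r, X(kX+Y)^{r-1}, (X+lY)^{r-1}Y` of `Xr1Sub p r`. -/
noncomputable def Xr1Generator (p r : ℕ) :
    Fin 2 ⊕ (ZMod p ⊕ ZMod p) → MvPolynomial (Fin 2) (ZMod p) :=
  Sum.elim ![X 0 ^ r, X 1 ^ r]
    (Sum.elim (fun k => X 0 * (C k * X 0 + X 1) ^ (r - 1))
      (fun l => (X 0 + C l * X 1) ^ (r - 1) * X 1))

theorem matAct_pow_mul (p s : ℕ) (g : Matrix (Fin 2) (Fin 2) (ZMod p)) :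
    matAct p g (X 0 ^ s * X 1) =
      (C (g 0 0) * X 0 + C (g 1 0) * X 1) ^ s * (C (g 0 1) * X 0 + C (g 1 1) * X 1) := by
  simp [matAct, Fin.sum_univ_two]

theorem span_Xr1Generator {p r : ℕ} [Fact p.Prime] (hr : r ≠ 0) :
    Submodule.span (ZMod p) (Set.range (Xr1Generator p r)) = Xr1Sub p r := by
  obtain ⟨s, rfl⟩ := Nat.exists_eq_succ_of_ne_zero hr
  apply le_antisymm
  · rw [Submodule.span_le, Set.range_subset_iff]
    have key (a b c d : ZMod p) :
        (C a * X 0 + C c * X 1) ^ s * (C b * X 0 + C d * X 1) ∈ Xr1Sub p (s + 1) :=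
      Submodule.subset_span ⟨!![a, b; c, d], by simpa using matAct_pow_mul p s !![a, b; c, d]⟩
    rintro (i | k | l)
    · fin_cases i
      · simpa [Xr1Generator, pow_succ] using key 1 1 0 0
      · simpa [Xr1Generator, pow_succ] using key 0 0 1 1
    · simpa [Xr1Generator, mul_comm] using key k 1 1 0
    · simpa [Xr1Generator] using key 1 0 l 1
  · refine Submodule.span_le.2 (Set.range_subset_iff.2 fun g => ?_)
    have hgen (i) : Xr1Generator p (s + 1) i ∈
        Submodule.span (ZMod p) (Set.range (Xr1Generator p (s + 1))) :=
      Submodule.subset_span ⟨i, rfl⟩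
    have hX (a c : ZMod p) : X 0 * (C a * X 0 + C c * X 1) ^ s ∈
        Submodule.span (ZMod p) (Set.range (Xr1Generator p (s + 1))) := by
      rcases eq_or_ne c 0 with rfl | hc
      · convert Submodule.smul_mem _ (a ^ s) (hgen (.inl 0)) using 1
        simp [Xr1Generator, smul_eq_C_mul]
        ring
      · convert Submodule.smul_mem _ (c ^ s) (hgen (.inr (.inl (a / c)))) using 1
        have : (C a : MvPolynomial (Fin 2) (ZMod p)) = C c * C (a / c) := by rw [← C_mul, mul_div_cancel₀ _ hc]
        simp only [Xr1Generator, smul_eq_C_mul, this, Sum.elim_inr, Sum.elim_inl, map_pow,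
          Nat.succ_sub_one]
        rw [mul_left_comm, ← mul_pow]
        ring
    have hY (a c : ZMod p) : (C a * X 0 + C c * X 1) ^ s * X 1 ∈
        Submodule.span (ZMod p) (Set.range (Xr1Generator p (s + 1))) := by
      rcases eq_or_ne a 0 with rfl | ha
      · convert Submodule.smul_mem _ (c ^ s) (hgen (.inl 1)) using 1
        simp [Xr1Generator, smul_eq_C_mul]
        ring
      · convert Submodule.smul_mem _ (a ^ s) (hgen (.inr (.inr (c / a)))) using 1
        have : (C c : MvPolynomial (Fin 2) (ZMod p)) = C a * C (c / a) := by rw [← C_mul, mul_div_cancel₀ _ ha]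
        simp only [Xr1Generator, smul_eq_C_mul, this, Sum.elim_inr, map_pow,
          Nat.succ_sub_one]
        rw [← mul_assoc, ← mul_pow]
        ring
    simp only [Nat.succ_eq_add_one, Nat.add_sub_cancel, matAct_pow_mul, SetLike.mem_coe]
    convert Submodule.add_mem _ (Submodule.smul_mem _ (g 0 1) (hX (g 0 0) (g 1 0)))
      (Submodule.smul_mem _ (g 1 1) (hY (g 0 0) (g 1 0))) using 1
    simp only [smul_eq_C_mul]
    ring

theorem linearIndependent_Xr1Generator {p r : ℕ} [Fact p.Prime] (hr : r ≠ 0) (hpr : ¬ p ∣ r)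
    (hsig : p ≤ (Nat.digits p (r - 1)).sum) :
    LinearIndependent (ZMod p) (Xr1Generator p r) := by
  obtain ⟨s, rfl⟩ := Nat.exists_eq_succ_of_ne_zero hr
  rw [Fintype.linearIndependent_iff]
  intro g hg
  have h : Polynomial.dehomogenizedCombination p s (g (.inl 0)) (g (.inl 1)) (fun k => g (.inr (.inl k)))
      (fun l => g (.inr (.inr l))) = 0 := by
    have := congrArg (aeval (R := ZMod p) ![1, (Polynomial.X : Polynomial (ZMod p))]) hg
    simp only [Fintype.sum_sum_type, Fin.sum_univ_two, Xr1Generator, smul_eq_C_mul, map_add,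
      map_sum, map_mul, map_pow, Sum.elim_inl, Sum.elim_inr, aeval_X, algHom_C, map_zero,
      Matrix.cons_val_zero, Matrix.cons_val_one, Polynomial.algebraMap_eq, one_pow, mul_one,
      one_mul, Nat.succ_sub_one] at this
    rw [← this, Polynomial.dehomogenizedCombination]
    simp only [add_comm Polynomial.X, Nat.succ_eq_add_one, add_assoc]
  obtain ⟨ha, hb, hc, hd⟩ := Polynomial.coefficients_eq_zero h hpr hsig
  rintro (i | k | l)
  · fin_cases i
    exacts [ha, hb]
  · exact congrFun hc k
  · exact congrFun hd l

/-- For a prime `p`, `r ≥ 2p+1` with `p ∤ r` and `Σ_p(r−1) ≥ p`,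
one has `dim X_{r−1} = 2p+2`; equivalently, the `2p+2` polynomials
`X^r, Y^r, X(kX+Y)^{r−1}, (X+lY)^{r−1}Y` (for `k, l ∈ F_p`) are linearly independent. -/
theorem dim_Xr1_full (p r : ℕ) (hp : p.Prime) (hr : 2 * p + 1 ≤ r) (hpr : ¬ p ∣ r)
    (hsig : p ≤ (Nat.digits p (r - 1)).sum) :
    Module.finrank (ZMod p) ↥(Xr1Sub p r) = 2 * p + 2 ∧
    LinearIndependent (ZMod p)
      (fun i : Fin 2 ⊕ (ZMod p ⊕ ZMod p) =>
        Sum.elim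
          (![(X 0 ^ r : MvPolynomial (Fin 2) (ZMod p)), X 1 ^ r])
          (Sum.elim
            (fun k : ZMod p => X 0 * (C k * X 0 + X 1) ^ (r - 1))
            (fun l : ZMod p => (X 0 + C l * X 1) ^ (r - 1) * X 1)) i) := by
  have := Fact.mk hp
  have hr0 : r ≠ 0 := by omega
  have hli := linearIndependent_Xr1Generator hr0 hpr hsig
  refine ⟨?_, hli⟩
  rw [← span_Xr1Generator hr0, finrank_span_eq_card hli]
  simp only [Fintype.card_sum, Fintype.card_fin, ZMod.card]
  ring
end

section
/- Let p ≥ 2 be a prime and r = p^n·u with n ≥ 1 and p ∤ u, and suppose r ≡ a mod (p−1) with 1 ≤ a ≤ p−1. If Σ_p(u−1) > a−1, then dim_{F_p} X_{r−1} = 2p + 2. -/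
open MvPolynomial

section DigitSums

variable {p : ℕ}

theorem digits_sum_eq_mod_add_div (hp : 1 < p) (n : ℕ) :
    (Nat.digits p n).sum = n % p + (Nat.digits p (n / p)).sum := by
  rcases Nat.eq_zero_or_pos n with rfl | hn
  · simp
  · rw [Nat.digits_def' hp hn, List.sum_cons]

theorem Nat.Prime.not_dvd_choose_of_lt_s15 (hp : p.Prime) {d e : ℕ} (hd : d < p) (he : e ≤ d) :
    ¬ p ∣ d.choose e := by
  intro h
  have h1 : p ∣ d.factorial := by
    rw [← Nat.choose_mul_factorial_mul_factorial he, mul_assoc]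
    exact h.mul_right _
  exact absurd (hp.dvd_factorial.1 h1) (by omega)

theorem not_dvd_choose_mul_add [Fact p.Prime] {d e u m : ℕ} (hd : d < p) (he : e ≤ d)
    (h : ¬ p ∣ u.choose m) : ¬ p ∣ (p * u + d).choose (p * m + e) := by
  have hp : p.Prime := Fact.out
  have key := Choose.choose_modEq_choose_mod_mul_choose_div_nat
    (p := p) (n := p * u + d) (k := p * m + e)
  rw [Nat.mul_add_mod, Nat.mul_add_mod, Nat.mul_add_div hp.pos, Nat.mul_add_div hp.pos,
    Nat.mod_eq_of_lt hd, Nat.mod_eq_of_lt (he.trans_lt hd), Nat.div_eq_of_lt hd,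
    Nat.div_eq_of_lt (he.trans_lt hd), add_zero, add_zero] at key
  rw [key.dvd_iff dvd_rfl, hp.dvd_mul]
  exact not_or.2 ⟨hp.not_dvd_choose_of_lt_s15 hd he, h⟩

theorem not_dvd_choose_pow_mul [Fact p.Prime] {u m : ℕ} (n : ℕ) (h : ¬ p ∣ u.choose m) :
    ¬ p ∣ (p ^ n * u).choose (p ^ n * m) := by
  induction n with
  | zero => simpa using h
  | succ n ih =>
    have := not_dvd_choose_mul_add (Nat.Prime.pos Fact.out) le_rfl ih
    simpa only [pow_succ', mul_assoc, add_zero] using this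

/-- By Lucas' theorem, every `t` up to the digit sum of `u` is the digit sum of some `m`
with `u.choose m` prime to `p`. -/
theorem exists_not_dvd_choose_digits_sum_eq [Fact p.Prime] (u t : ℕ)
    (ht : t ≤ (Nat.digits p u).sum) :
    ∃ m, ¬ p ∣ u.choose m ∧ (Nat.digits p m).sum = t := by
  have hp : p.Prime := Fact.out
  induction u using Nat.strong_induction_on generalizing t with
  | _ u ih =>
    rcases Nat.eq_zero_or_pos u with rfl | hu
    · refine ⟨0, ?_, ?_⟩
      · simpa using hp.one_lt.ne'
      · simp at ht ⊢; omega
    · rw [digits_sum_eq_mod_add_div hp.one_lt] at ht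
      obtain ⟨m, hm, hmt⟩ := ih (u / p) (Nat.div_lt_self hu hp.one_lt)
        (t - min (u % p) t) (by omega)
      have hlt := Nat.mod_lt u hp.pos
      have hmin : min (u % p) t < p := by omega
      refine ⟨p * m + min (u % p) t, ?_, ?_⟩
      · have := not_dvd_choose_mul_add hlt (min_le_left (u % p) t) hm
        rwa [Nat.div_add_mod] at this
      · rw [digits_sum_eq_mod_add_div hp.one_lt, Nat.mul_add_mod, Nat.mul_add_div hp.pos,
          Nat.mod_eq_of_lt hmin, Nat.div_eq_of_lt hmin, add_zero, hmt]
        omega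

theorem modEq_pred_digits_sum (hp : p.Prime) (n : ℕ) :
    n ≡ (Nat.digits p n).sum [MOD p - 1] := by
  rcases hp.two_le.eq_or_lt with rfl | h
  · exact Nat.modEq_one
  · refine Nat.modEq_digits_sum _ _ ?_ n
    obtain ⟨q, rfl⟩ := Nat.exists_eq_add_of_lt h
    rw [show 2 + q + 1 = 1 + (2 + q) by ring, Nat.add_sub_cancel_left, Nat.add_mod_right]
    exact Nat.mod_eq_of_lt (by omega)

theorem digits_sum_pred_add_one [Fact p.Prime] {u : ℕ} (hu : ¬ p ∣ u) :
    (Nat.digits p u).sum = (Nat.digits p (u - 1)).sum + 1 := by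
  have hp : p.Prime := Fact.out
  have h0 : u % p ≠ 0 := fun h => hu (Nat.dvd_of_mod_eq_zero h)
  have hlt := Nat.mod_lt u hp.pos
  have hpred : u - 1 = p * (u / p) + (u % p - 1) := by
    have := Nat.div_add_mod u p
    omega
  have hlt' : u % p - 1 < p := by omega
  rw [digits_sum_eq_mod_add_div hp.one_lt u, digits_sum_eq_mod_add_div hp.one_lt (u - 1), hpred,
    Nat.mul_add_mod, Nat.mul_add_div hp.pos, Nat.mod_eq_of_lt hlt', Nat.div_eq_of_lt hlt', add_zero]
  omega

theorem le_digits_sum_of_lt_digits_sum_pred [Fact p.Prime] {u a : ℕ} (hu : ¬ p ∣ u)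
    (ha : 1 ≤ a) (hua : u ≡ a [MOD p - 1])
    (h : a - 1 < (Nat.digits p (u - 1)).sum) : p ≤ (Nat.digits p u).sum := by
  have hp : p.Prime := Fact.out
  have h1 := digits_sum_pred_add_one hu
  have h2 : a ≡ (Nat.digits p u).sum [MOD p - 1] :=
    hua.symm.trans (modEq_pred_digits_sum hp u)
  have h3 := (Nat.modEq_iff_dvd' (by omega)).1 h2
  have h4 := Nat.le_of_dvd (by omega) h3
  omega

end DigitSums

section PowerSums

variable {p : ℕ} [Fact p.Prime]

theorem ZMod.pow_eq_pow_of_modEq {i j : ℕ} (h : i ≡ j [MOD p - 1]) (h0 : i = 0 ↔ j = 0)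
    (k : ZMod p) : k ^ i = k ^ j := by
  by_cases hk : k = 0
  · subst hk
    by_cases hi : i = 0
    · rw [hi, h0.1 hi]
    · rw [zero_pow hi, zero_pow (fun hj => hi (h0.2 hj))]
  · rw [← Nat.div_add_mod i (p - 1), ← Nat.div_add_mod j (p - 1), show i % (p - 1) = _ from h,
      pow_add, pow_add, pow_mul, pow_mul, ZMod.pow_card_sub_one_eq_one hk, one_pow, one_pow]

theorem ZMod.sum_mul_pow_congr (f : ZMod p → ZMod p) {i j : ℕ} (h : i ≡ j [MOD p - 1])
    (h0 : i = 0 ↔ j = 0) : ∑ k, f k * k ^ i = ∑ k, f k * k ^ j :=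
  Finset.sum_congr rfl fun k _ => by rw [ZMod.pow_eq_pow_of_modEq h h0]

theorem ZMod.eq_zero_of_sum_mul_pow_eq_zero (f : ZMod p → ZMod p)
    (h : ∀ t < p, ∑ k, f k * k ^ t = 0) : f = 0 := by
  have hc : Fintype.card (ZMod p) = p := ZMod.card p
  let e := (Fintype.equivFinOfCardEq hc).symm
  have : f ∘ e = 0 := by
    refine Matrix.eq_zero_of_forall_pow_sum_mul_pow_eq_zero e.injective fun i => ?_
    rw [← h i i.2, ← e.sum_comp]
    rfl
  funext k
  simpa using congrFun this (e.symm k)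

end PowerSums

section CoefficientEquations

variable {p : ℕ} [Fact p.Prime] {α β : ZMod p → ZMod p} {γ δ : ZMod p} {r n u : ℕ}

/-- The equations saying that the coefficients of `T ^ (j + 1)` vanish in
`∑ k, (α k (1 + k T) ^ r + β k (1 + k T) ^ (r - 1) T) + γ T ^ r + δ T ^ (r - 1)`. -/
def CoeffEqns (r : ℕ) (α β : ZMod p → ZMod p) (γ δ : ZMod p) : Prop :=
  ∀ j : ℕ, (r.choose (j + 1) : ZMod p) * ∑ k, α k * k ^ (j + 1)
    + ((r - 1).choose j : ZMod p) * ∑ k, β k * k ^ j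
    + (if j + 1 = r then γ else 0) + (if j + 1 = r - 1 then δ else 0) = 0

theorem CoeffEqns.sum_beta_eq_zero {w m s : ℕ} (h : CoeffEqns (p * w) α β γ δ) (hw : 0 < w)
    (hs : s + 1 < p) (hm : ¬ p ∣ (w - 1).choose m) (hne : m = w - 1 → s + 2 ≠ p) :
    ∑ k, β k * k ^ (p * m + s) = 0 := by
  have hp : p.Prime := Fact.out
  have hpw : p * w = p * (w - 1) + p := by
    rw [← Nat.mul_succ, Nat.succ_eq_add_one, Nat.sub_add_cancel hw]
  have hdiv : ¬ p ∣ p * m + s + 1 := by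
    rw [add_assoc, Nat.dvd_add_right (dvd_mul_right p m)]
    exact Nat.not_dvd_of_pos_of_lt (by omega) hs
  have h1 : ((p * w).choose (p * m + s + 1) : ZMod p) = 0 := by
    rw [ZMod.natCast_eq_zero_iff]
    have key := Choose.choose_modEq_choose_mod_mul_choose_div_nat
      (p := p) (n := p * w) (k := p * m + s + 1)
    rw [key.dvd_iff dvd_rfl, Nat.mul_mod_right, add_assoc, Nat.mul_add_mod, Nat.mod_eq_of_lt hs]
    simp
  have h2 : ((p * w - 1).choose (p * m + s) : ZMod p) ≠ 0 := by
    rw [Ne, ZMod.natCast_eq_zero_iff, hpw, Nat.add_sub_assoc hp.one_le]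
    exact not_dvd_choose_mul_add (by omega) (by omega) hm
  have h3 : p * m + s + 1 ≠ p * w := fun e => hdiv (e ▸ dvd_mul_right p w)
  have h4 : p * m + s + 1 ≠ p * w - 1 := by
    intro e
    have hme : p * m + (s + 2) = p * (w - 1) + p := by omega
    have hdvd : p ∣ s + 2 := by
      rw [← Nat.dvd_add_right (dvd_mul_right p m), hme]
      exact (dvd_mul_right _ _).add dvd_rfl
    have hsp : s + 2 = p := le_antisymm (by omega) (Nat.le_of_dvd (by omega) hdvd)
    refine hne ?_ hsp
    exact Nat.eq_of_mul_eq_mul_left hp.pos (by omega)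
  have := h (p * m + s)
  rw [h1, if_neg h3, if_neg h4] at this
  simpa [h2] using this

theorem CoeffEqns.sum_beta_pow_pred_eq_zero {w m : ℕ} (h : CoeffEqns (p * w) α β γ δ)
    (hm0 : 0 < m) (hm : m < w - 1) (hmw : ¬ p ∣ (w - 1).choose m) :
    ∑ k, β k * k ^ (p - 1) = 0 := by
  have hp : p.Prime := Fact.out
  have hp1 : 0 < p - 1 := by have := hp.two_le; omega
  obtain ⟨s, hs, hms⟩ : ∃ s, s < p - 1 ∧ m + s ≡ 0 [MOD p - 1] := by
    refine ⟨(m * (p - 2)) % (p - 1), Nat.mod_lt _ hp1, ?_⟩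
    have : m + m * (p - 2) = (p - 1) * m := by
      have : p - 1 = (p - 2) + 1 := by omega
      rw [this]; ring
    refine ((Nat.ModEq.refl m).add (Nat.mod_modEq _ _)).trans ?_
    rw [this]
    exact (Nat.modEq_zero_iff_dvd.2 (dvd_mul_right _ _))
  rw [← h.sum_beta_eq_zero (by omega) (by omega) hmw (by omega) (s := s)]
  refine ZMod.sum_mul_pow_congr β ?_ ?_
  · have e : p * m + s = (p - 1) * m + (m + s) := by
      have : p = (p - 1) + 1 := by omega
      conv_lhs => rw [this]
      ring
    rw [e]
    refine (Nat.modEq_zero_iff_dvd.2 dvd_rfl).trans (Nat.ModEq.symm ?_)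
    simpa using (Nat.modEq_zero_iff_dvd.2 (dvd_mul_right (p - 1) m)).add hms
  · have := Nat.mul_pos hp.pos hm0
    omega

theorem CoeffEqns.beta_eq_zero {w : ℕ} (h : CoeffEqns (p * w) α β γ δ) (hw : 2 ≤ w)
    (hpred : ∑ k, β k * k ^ (p - 1) = 0) : β = 0 := by
  have hp : p.Prime := Fact.out
  refine ZMod.eq_zero_of_sum_mul_pow_eq_zero β fun t ht => ?_
  rcases (Nat.le_sub_one_of_lt ht).eq_or_lt with rfl | ht'
  · exact hpred
  · have := h.sum_beta_eq_zero (m := 0) (s := t) (by omega) (by omega)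
      (by simpa using hp.one_lt.ne') (by omega)
    simpa using this

theorem sum_beta_pred_eq_zero_of_two {α β : ZMod 2 → ZMod 2} {γ δ : ZMod 2}
    (h : CoeffEqns (2 * u) α β γ δ) (hu : ¬ 2 ∣ u) (hu2 : 2 ≤ u) :
    ∑ k, β k * k ^ (2 - 1) = 0 := by
  obtain ⟨v, rfl⟩ : ∃ v, u = 2 * v + 1 := ⟨u / 2, by omega⟩
  have hv : 1 ≤ v := by omega
  have red (f : ZMod 2 → ZMod 2) (i : ℕ) (hi : i ≠ 0) :
      ∑ k, f k * k ^ i = ∑ k, f k * k ^ 1 :=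
    ZMod.sum_mul_pow_congr f Nat.modEq_one (by omega)
  have c1 : ((2 * (2 * v + 1)).choose 2 : ZMod 2) = 1 := by
    rw [Nat.choose_two_right, mul_assoc, Nat.mul_div_cancel_left _ (by norm_num),
      show 2 * (2 * v + 1) - 1 = 2 * (2 * v) + 1 by omega]
    push_cast
    rw [show (2 : ZMod 2) = 0 from rfl]
    ring
  have c2 : ((2 * (2 * v + 1) - 1).choose 2 : ZMod 2) = 0 := by
    rw [Nat.choose_two_right, show 2 * (2 * v + 1) - 1 = 4 * v + 1 by omega, Nat.add_sub_cancel,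
      show (4 * v + 1) * (4 * v) = 2 * (2 * ((4 * v + 1) * v)) by ring,
      Nat.mul_div_cancel_left _ (by norm_num)]
    push_cast
    rw [show (2 : ZMod 2) = 0 from rfl]
    ring
  have e1 := h 1
  have e2 := h (4 * v - 1)
  rw [if_neg (by omega), if_neg (by omega), c1, red α _ (by omega), Nat.choose_one_right,
    show 2 * (2 * v + 1) - 1 = 2 * (2 * v) + 1 by omega] at e1
  rw [if_neg (by omega), if_neg (by omega), red α _ (by omega), Nat.sub_add_cancel (by omega),
    Nat.choose_symm_of_eq_add (show 2 * (2 * v + 1) = 4 * v + 2 by omega), c1,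
    Nat.choose_symm_of_eq_add (show 2 * (2 * v + 1) - 1 = (4 * v - 1) + 2 by omega), c2] at e2
  push_cast at e1
  rw [show (2 : ZMod 2) = 0 from rfl] at e1
  simp only [zero_mul, add_zero, zero_add, one_mul] at e1 e2
  rw [e2, zero_add] at e1
  exact e1

theorem CoeffEqns.beta_eq_zero_of_pow_mul (h : CoeffEqns (p ^ n * u) α β γ δ) (hn : 1 ≤ n)
    (hu : ¬ p ∣ u) (hu2 : 2 ≤ u) (hsig : p ≤ (Nat.digits p u).sum) : β = 0 := by
  have hp : p.Prime := Fact.out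
  obtain ⟨n, rfl⟩ := Nat.exists_eq_add_of_le' hn
  rw [pow_succ', mul_assoc] at h
  have hpn : 0 < p ^ n := pow_pos hp.pos n
  have hw : 2 ≤ p ^ n * u := hu2.trans (Nat.le_mul_of_pos_left u hpn)
  refine h.beta_eq_zero hw ?_
  rcases n with _ | n
  · rw [pow_zero, one_mul] at h
    rcases hp.two_le.eq_or_lt with rfl | hp2
    · exact sum_beta_pred_eq_zero_of_two h hu hu2
    · have h1 := digits_sum_pred_add_one hu
      obtain ⟨m, hm, hms⟩ := exists_not_dvd_choose_digits_sum_eq (p := p) (u - 1) 1 (by omega)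
      have hle : m ≤ u - 1 := by
        by_contra! hlt
        exact hm (by rw [Nat.choose_eq_zero_of_lt hlt]; exact dvd_zero p)
      refine h.sum_beta_pow_pred_eq_zero (m := m) ?_ (hle.lt_of_ne ?_) hm
      · rcases Nat.eq_zero_or_pos m with rfl | hm0
        · simp at hms
        · exact hm0
      · rintro rfl
        omega
  · have hdvd : p ∣ p ^ (n + 1) * u := (dvd_pow_self p n.succ_ne_zero).mul_right u
    have h4 : 2 * 2 ≤ p ^ (n + 1) * u :=
      Nat.mul_le_mul (hp.two_le.trans (Nat.le_self_pow n.succ_ne_zero p)) hu2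
    refine h.sum_beta_pow_pred_eq_zero (m := 1) one_pos (by omega) ?_
    rw [Nat.choose_one_right]
    intro h1
    have := (Nat.dvd_sub hdvd h1)
    rw [Nat.sub_sub_self (by omega)] at this
    exact hp.one_lt.ne' (Nat.dvd_one.1 this)

theorem CoeffEqns.eq_zero (h : CoeffEqns (p ^ n * u) α β γ δ) (h0 : ∑ k, α k = 0) (hn : 1 ≤ n)
    (hu : ¬ p ∣ u) (hu2 : 2 ≤ u) (hsig : p ≤ (Nat.digits p u).sum) :
    α = 0 ∧ β = 0 ∧ γ = 0 ∧ δ = 0 := by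
  have hp : p.Prime := Fact.out
  have hβ := h.beta_eq_zero_of_pow_mul hn hu hu2 hsig
  subst hβ
  have hpn : p ≤ p ^ n := Nat.le_self_pow (by omega) p
  have hr : 2 * 2 ≤ p ^ n * u := Nat.mul_le_mul (hp.two_le.trans hpn) hu2
  have hδ : δ = 0 := by
    have e := h (p ^ n * u - 2)
    have hc : ((p ^ n * u).choose (p ^ n * u - 1) : ZMod p) = 0 := by
      rw [Nat.choose_symm (by omega), Nat.choose_one_right, ZMod.natCast_eq_zero_iff]
      exact (dvd_pow_self p (by omega)).mul_right u
    rw [if_neg (by omega), if_pos (by omega),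
      show p ^ n * u - 2 + 1 = p ^ n * u - 1 by omega, hc] at e
    simpa using e
  subst hδ
  have hα : α = 0 := by
    refine ZMod.eq_zero_of_sum_mul_pow_eq_zero α fun t ht => ?_
    rcases Nat.eq_zero_or_pos t with rfl | ht0
    · simpa using h0
    obtain ⟨m, hm, hms⟩ := exists_not_dvd_choose_digits_sum_eq (p := p) u t (by omega)
    have hle : m ≤ u := by
      by_contra! hlt
      exact hm (by rw [Nat.choose_eq_zero_of_lt hlt]; exact dvd_zero p)
    have hlt : m < u := hle.lt_of_ne (by rintro rfl; omega)
    have hm0 : m ≠ 0 := by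
      rintro rfl
      simp at hms
      omega
    have hpos : 0 < p ^ n * m := Nat.mul_pos (by have := hp.pos; omega) (by omega)
    have hlt' : p ^ n * m < p ^ n * u := Nat.mul_lt_mul_of_pos_left hlt (by have := hp.pos; omega)
    have e := h (p ^ n * m - 1)
    rw [Nat.sub_add_cancel hpos, if_neg hlt'.ne] at e
    have hc : ((p ^ n * u).choose (p ^ n * m) : ZMod p) ≠ 0 := by
      rw [Ne, ZMod.natCast_eq_zero_iff]
      exact not_dvd_choose_pow_mul n hm
    have e' : ∑ k, α k * k ^ (p ^ n * m) = 0 := by simpa [hc] using e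
    rw [← e']
    refine ZMod.sum_mul_pow_congr α ?_ (by omega)
    have hp1 : p ≡ 1 [MOD p - 1] := ((Nat.modEq_iff_dvd' hp.one_le).2 dvd_rfl).symm
    have := ((hp1.pow n).mul_right m).trans (by simpa using modEq_pred_digits_sum hp m)
    rw [hms] at this
    exact this.symm
  subst hα
  have e := h (p ^ n * u - 1)
  rw [if_pos (by omega)] at e
  exact ⟨rfl, rfl, by simpa using e, rfl⟩

end CoefficientEquations

section Generators

variable {p : ℕ}

/-- A linear form for each point of the projective line: `X + k Y` for `k` finite, `Y` at
infinity. -/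
noncomputable def lineForm : Option (ZMod p) → MvPolynomial (Fin 2) (ZMod p)
  | some k => X 0 + C k * X 1
  | none => X 1

/-- A linear form which together with `lineForm o` spans all linear forms. -/
noncomputable def complForm : Option (ZMod p) → MvPolynomial (Fin 2) (ZMod p)
  | some _ => X 1
  | none => X 0

/-- The spanning family of `Xr1Sub p r`. -/
noncomputable def genFamily (p r : ℕ) :
    Option (ZMod p) ⊕ Option (ZMod p) → MvPolynomial (Fin 2) (ZMod p)
  | Sum.inl o => lineForm o ^ r
  | Sum.inr o => lineForm o ^ (r - 1) * complForm o

theorem matAct_X (g : Matrix (Fin 2) (Fin 2) (ZMod p)) (i : Fin 2) :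
    matAct p g (X i) = C (g 0 i) * X 0 + C (g 1 i) * X 1 := by
  simp [matAct]

theorem matAct_gen (g : Matrix (Fin 2) (Fin 2) (ZMod p)) (r : ℕ) :
    matAct p g (X 0 ^ (r - 1) * X 1) =
      (C (g 0 0) * X 0 + C (g 1 0) * X 1) ^ (r - 1) * (C (g 0 1) * X 0 + C (g 1 1) * X 1) := by
  rw [map_mul, map_pow, matAct_X, matAct_X]

theorem mul_mem_span_genFamily {r : ℕ} (hr : 1 ≤ r) (o : Option (ZMod p)) (c x y : ZMod p) :
    (C c * lineForm o) ^ (r - 1) * (C x * lineForm o + C y * complForm o) ∈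
      Submodule.span (ZMod p) (Set.range (genFamily p r)) := by
  have e : (C c * lineForm o) ^ (r - 1) * (C x * lineForm o + C y * complForm o) =
      (c ^ (r - 1) * x) • genFamily p r (Sum.inl o) +
        (c ^ (r - 1) * y) • genFamily p r (Sum.inr o) := by
    obtain ⟨s, rfl⟩ := Nat.exists_eq_add_of_le' hr
    simp only [genFamily, smul_eq_C_mul, C_mul, C_pow, Nat.add_sub_cancel]
    ring
  rw [e]
  exact Submodule.add_mem _
    (Submodule.smul_mem _ _ (Submodule.subset_span (Set.mem_range_self _)))
    (Submodule.smul_mem _ _ (Submodule.subset_span (Set.mem_range_self _)))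

theorem Xr1Sub_eq_span_genFamily [Fact p.Prime] {r : ℕ} (hr : 2 ≤ r) :
    Xr1Sub p r = Submodule.span (ZMod p) (Set.range (genFamily p r)) := by
  refine le_antisymm (Submodule.span_le.2 ?_) (Submodule.span_mono ?_)
  · rintro _ ⟨g, rfl⟩
    simp only [SetLike.mem_coe, matAct_gen]
    by_cases h0 : g 0 0 = 0
    · have := mul_mem_span_genFamily (r := r) (by omega) none (g 1 0) (g 1 1) (g 0 1)
      simpa [lineForm, complForm, h0, add_comm] using this
    · have := mul_mem_span_genFamily (r := r) (by omega) (some (g 1 0 / g 0 0)) (g 0 0) (g 0 1)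
        (g 1 1 - g 0 1 * (g 1 0 / g 0 0))
      convert this using 2
      · simp only [lineForm, mul_add, ← mul_assoc, ← C_mul, mul_div_cancel₀ _ h0]
      · simp only [lineForm, complForm, C_sub, C_mul]
        ring
  · rintro _ ⟨i, rfl⟩
    obtain ⟨s, rfl⟩ := Nat.exists_eq_add_of_le' (one_le_two.trans hr)
    rcases i with (_ | k) | (_ | k)
    · exact ⟨!![0, 0; 1, 1], by simp [matAct_X, genFamily, lineForm, pow_succ]⟩
    · exact ⟨!![1, 1; k, k], by simp [matAct_X, genFamily, lineForm, pow_succ]⟩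
    · exact ⟨!![0, 1; 1, 0], by simp [matAct_X, genFamily, lineForm, complForm]⟩
    · exact ⟨!![1, 0; k, 1], by simp [matAct_X, genFamily, lineForm, complForm]⟩

theorem coeff_one_add_C_mul_X_pow (k : ZMod p) (m j : ℕ) :
    ((1 + Polynomial.C k * Polynomial.X) ^ m : Polynomial (ZMod p)).coeff j =
      m.choose j * k ^ j := by
  have : (1 + Polynomial.C k * Polynomial.X : Polynomial (ZMod p)) ^ m =
      ((1 + Polynomial.X) ^ m : Polynomial (ZMod p)).comp (Polynomial.C k * Polynomial.X) := by
    simp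
  rw [this, Polynomial.comp_C_mul_X_coeff, Polynomial.coeff_one_add_X_pow]

theorem linearIndependent_genFamily [Fact p.Prime] {n u : ℕ} (hn : 1 ≤ n) (hu : ¬ p ∣ u)
    (hu2 : 2 ≤ u) (hsig : p ≤ (Nat.digits p u).sum) :
    LinearIndependent (ZMod p) (genFamily p (p ^ n * u)) := by
  have hp : p.Prime := Fact.out
  have hr : 2 * 2 ≤ p ^ n * u :=
    Nat.mul_le_mul (hp.two_le.trans (Nat.le_self_pow (by omega) p)) hu2
  rw [Fintype.linearIndependent_iff]
  intro g hg
  have hpoly := congrArg (aeval ![(1 : Polynomial (ZMod p)), Polynomial.X]) hg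
  simp only [Fintype.sum_sum_type, Fintype.sum_option, genFamily, lineForm, complForm, map_add,
    map_sum, map_smul, map_mul, map_pow, map_zero, aeval_X, algHom_C, Matrix.cons_val_zero,
    Matrix.cons_val_one, Polynomial.algebraMap_eq, mul_one] at hpoly
  have hcoeff (j : ℕ) := congrArg (fun q => Polynomial.coeff q j) hpoly
  simp only [Polynomial.coeff_add, Polynomial.finsetSum_coeff, Polynomial.coeff_smul,
    Polynomial.coeff_X_pow, coeff_one_add_C_mul_X_pow, smul_eq_mul, Polynomial.coeff_zero] at hcoeff
  have h0 : ∑ k, g (Sum.inl (some k)) = 0 := by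
    have e := hcoeff 0
    rw [if_neg (by omega), if_neg (by omega)] at e
    simpa using e
  have heq : CoeffEqns (p ^ n * u) (fun k => g (Sum.inl (some k))) (fun k => g (Sum.inr (some k)))
      (g (Sum.inl none)) (g (Sum.inr none)) := by
    intro j
    have e := hcoeff (j + 1)
    simp only [Polynomial.coeff_mul_X, coeff_one_add_C_mul_X_pow] at e
    refine Eq.trans ?_ e
    rw [Finset.mul_sum, Finset.mul_sum]
    simp only [mul_left_comm, mul_ite, mul_one, mul_zero]
    abel
  obtain ⟨hα, hβ, hγ, hδ⟩ := heq.eq_zero h0 hn hu hu2 hsig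
  rintro ((_ | k) | (_ | k))
  · exact hγ
  · exact congrFun hα k
  · exact hδ
  · exact congrFun hβ k

end Generators

/-- For a prime `p` and `r = p^n u` with `n ≥ 1`, `p ∤ u`,
`r ≡ a mod (p−1)` with `1 ≤ a ≤ p−1`, if `Σ_p(u−1) > a−1` then `dim X_{r−1} = 2p+2`. -/
theorem dim_Xr1_full_pdvd (p r a n u : ℕ) (hp : p.Prime)
    (hru : r = p ^ n * u) (hn : 1 ≤ n) (hu : ¬ p ∣ u)
    (hmod : r ≡ a [MOD p - 1]) (ha : 1 ≤ a) (ha2 : a ≤ p - 1)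
    (hsig : a - 1 < (Nat.digits p (u - 1)).sum) :
    Module.finrank (ZMod p) ↥(Xr1Sub p r) = 2 * p + 2 := by
  have := Fact.mk hp
  have hua : u ≡ a [MOD p - 1] := by
    have hp1 : p ≡ 1 [MOD p - 1] := ((Nat.modEq_iff_dvd' hp.one_le).2 dvd_rfl).symm
    have h := (hp1.pow n).mul_right u
    rw [one_pow, one_mul, ← hru] at h
    exact h.symm.trans hmod
  have hu2 : 2 ≤ u := by
    by_contra! h
    rw [show u - 1 = 0 by omega] at hsig
    simp at hsig
  have hr : 2 ≤ r := hru ▸ hu2.trans (Nat.le_mul_of_pos_left u (pow_pos hp.pos n))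
  rw [Xr1Sub_eq_span_genFamily hr, hru, finrank_span_eq_card
    (linearIndependent_genFamily hn hu hu2
      (le_digits_sum_of_lt_digits_sum_pred hu ha hua hsig))]
  simp only [Fintype.card_sum, Fintype.card_option, ZMod.card]
  ring
end

section
/- Let p ≥ 2 be a prime and r ≥ p. Then X_r is a proper subset of X_{r−1}, i.e., X_r ⊆ X_{r−1} and X_r ≠ X_{r−1}. -/
open MvPolynomial

/-- A power of `p` in the interval `(r / p, r]` gives a binomial coefficient
prime to `p`. -/
theorem not_dvd_choose_pow_of_le_of_lt {p : ℕ} (hp : p.Prime) (k r : ℕ) (hk : p ^ k ≤ r)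
    (hk' : r < p ^ (k + 1)) : ¬ p ∣ r.choose (p ^ k) := by
  have := Fact.mk hp
  induction k generalizing r with
  | zero =>
    simp only [pow_zero, zero_add, pow_one, Nat.choose_one_right] at *
    exact Nat.not_dvd_of_pos_of_lt hk hk'
  | succ k ih =>
    have hmod := Choose.choose_modEq_choose_mod_mul_choose_div_nat (p := p) (n := r)
      (k := p ^ (k + 1))
    have h0 : p ^ (k + 1) % p = 0 := Nat.mod_eq_zero_of_dvd (dvd_pow_self p k.succ_ne_zero)
    have h1 : p ^ (k + 1) / p = p ^ k := by rw [pow_succ, Nat.mul_div_cancel _ hp.pos]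
    rw [h0, h1, Nat.choose_zero_right, one_mul] at hmod
    rw [hmod.dvd_iff dvd_rfl]
    apply ih
    · rwa [Nat.le_div_iff_mul_le hp.pos, ← pow_succ]
    · rwa [Nat.div_lt_iff_lt_mul hp.pos, ← pow_succ]

/-- The coefficient of `T ^ j` in the dehomogenization `F (1, T)`. -/
noncomputable def dehomCoeff (p j : ℕ) : MvPolynomial (Fin 2) (ZMod p) →ₗ[ZMod p] ZMod p :=
  Polynomial.lcoeff (ZMod p) j ∘ₗ
    (aeval ![(1 : Polynomial (ZMod p)), Polynomial.X]).toLinearMap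

theorem dehomCoeff_X_pow_mul_X (p j n : ℕ) :
    dehomCoeff p j (X 0 ^ n * X 1) = if j = 1 then 1 else 0 := by
  simp [dehomCoeff, Polynomial.coeff_X, eq_comm]

theorem dehomCoeff_matAct_X_pow (p j r : ℕ) (g : Matrix (Fin 2) (Fin 2) (ZMod p)) :
    dehomCoeff p j (matAct p g (X 0 ^ r)) =
      g 0 0 ^ (r - j) * g 1 0 ^ j * (r.choose j : ZMod p) := by
  have h : aeval ![(1 : Polynomial (ZMod p)), Polynomial.X] (matAct p g (X 0 ^ r)) =
      (Polynomial.C (g 1 0) * Polynomial.X + Polynomial.C (g 0 0)) ^ r := by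
    simp [matAct, Fin.sum_univ_two, Polynomial.algebraMap_eq, add_comm]
  simp only [dehomCoeff, LinearMap.comp_apply, AlgHom.toLinearMap_apply, h,
    Polynomial.lcoeff_apply, add_pow, Polynomial.finsetSum_coeff, mul_pow, ← Polynomial.C_pow,
    ← Polynomial.C_eq_natCast, Polynomial.coeff_mul_C, Polynomial.coeff_C_mul,
    Polynomial.coeff_X_pow, mul_ite, ite_mul, mul_one, mul_zero, zero_mul]
  rw [Finset.sum_ite_eq]
  split_ifs with hj
  · ring
  · rw [Nat.choose_eq_zero_of_lt (by simpa using hj)]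
    simp

theorem XrSub_le_Xr1Sub (p : ℕ) {r : ℕ} (hr : r ≠ 0) : XrSub p r ≤ Xr1Sub p r := by
  rw [XrSub, Submodule.span_le]
  rintro _ ⟨g, rfl⟩
  refine Submodule.subset_span ⟨Matrix.of fun i _ => g i 0, ?_⟩
  obtain ⟨n, rfl⟩ := Nat.exists_eq_succ_of_ne_zero hr
  simp [matAct, pow_succ]

/-- A linear functional vanishing on `XrSub p r` and not on `X ^ (r - 1) * Y` separates the two
submodules. -/
theorem XrSub_ne_Xr1Sub_of_functional {p r : ℕ}
    (φ : MvPolynomial (Fin 2) (ZMod p) →ₗ[ZMod p] ZMod p)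
    (hφ : ∀ g, φ (matAct p g (X 0 ^ r)) = 0) (hφ' : φ (X 0 ^ (r - 1) * X 1) ≠ 0) :
    XrSub p r ≠ Xr1Sub p r := by
  intro h
  have hle : XrSub p r ≤ LinearMap.ker φ := by
    rw [XrSub, Submodule.span_le]
    rintro _ ⟨g, rfl⟩
    exact hφ g
  refine hφ' (hle (h ▸ Submodule.subset_span ⟨1, ?_⟩))
  simp [matAct, Fin.sum_univ_two]

theorem pow_sub_one_eq_pow_sub_prime_pow {p : ℕ} [Fact p.Prime] (a : ZMod p) {k r : ℕ}
    (hk : p ^ k < r) : a ^ (r - 1) = a ^ (r - p ^ k) := by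
  have hpos : 0 < p ^ k := pow_pos (Fact.out : p.Prime).pos k
  obtain ⟨m, rfl⟩ := Nat.exists_eq_add_of_lt hk
  rw [show p ^ k + m + 1 - 1 = p ^ k + m by omega, show p ^ k + m + 1 - p ^ k = m + 1 by omega,
    pow_add, ZMod.pow_card_pow, pow_succ']

/-- For a prime `p` and `r ≥ p`, `X_r` is a proper submodule of
`X_{r−1}`. -/
theorem Xr_lt_Xr1 (p r : ℕ) (hp : p.Prime) (hr : p ≤ r) :
    XrSub p r ≤ Xr1Sub p r ∧ XrSub p r ≠ Xr1Sub p r := by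
  have := Fact.mk hp
  refine ⟨XrSub_le_Xr1Sub p (hp.pos.trans_le hr).ne', ?_⟩
  by_cases hpr : p ∣ r
  · refine XrSub_ne_Xr1Sub_of_functional (dehomCoeff p 1) (fun g => ?_) ?_
    · rw [dehomCoeff_matAct_X_pow, Nat.choose_one_right, (ZMod.natCast_eq_zero_iff r p).2 hpr,
        mul_zero]
    · simp [dehomCoeff_X_pow_mul_X]
  · have hr0 : r ≠ 0 := (hp.pos.trans_le hr).ne'
    set k := Nat.log p r with hk
    have hk0 : k ≠ 0 := (Nat.log_pos hp.one_lt hr).ne'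
    have hle : p ^ k ≤ r := Nat.pow_log_le_self p hr0
    have hlt : p ^ k < r :=
      lt_of_le_of_ne hle fun h => hpr (h ▸ dvd_pow_self p hk0)
    have hchoose := not_dvd_choose_pow_of_le_of_lt hp k r hle
      (Nat.lt_pow_succ_log_self hp.one_lt r)
    refine XrSub_ne_Xr1Sub_of_functional
      ((r.choose (p ^ k) : ZMod p) • dehomCoeff p 1 - (r : ZMod p) • dehomCoeff p (p ^ k))
      (fun g => ?_) ?_
    · simp only [LinearMap.sub_apply, LinearMap.smul_apply, dehomCoeff_matAct_X_pow, smul_eq_mul,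
        Nat.choose_one_right, ZMod.pow_card_pow, pow_one,
        pow_sub_one_eq_pow_sub_prime_pow (g 0 0) hlt]
      ring
    · have hne : p ^ k ≠ 1 := (Nat.one_lt_pow hk0 hp.one_lt).ne'
      simp only [LinearMap.sub_apply, LinearMap.smul_apply, dehomCoeff_X_pow_mul_X, if_neg hne,
        if_true, smul_eq_mul, mul_one, mul_zero, sub_zero]
      rwa [Ne, ZMod.natCast_eq_zero_iff]
end
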